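/- Let k ≥ 2, and let n, t be integers with 1 ≤ t ≤ 2k−2 and n ≥ 252t²k. Let G be a C_{2k+1}-free graph on n vertices with e(G) ≥ ⌊(n−t−1)²/4⌋ + (t+2 choose 2), and let B = {v ∈ V(G) : deg_G(v) < 2√(tn)}. Then |B| ≤ t+1 and there is a partition of V(G) \ B into sets X and Y such that no edge of G joins two vertices of X or two vertices of Y, and moreover: (ii) n/2 − 2√(tn) ≤ |X|, |Y| ≤ n/2 + 2√(tn); (iii) the number of vertices v ∈ V(G) \ B whose degree in G − B is at most n/2 − √(3tn) is at most (3/2)√(tn); (iv) for every v ∈ B, either all neighbors of v lying in X ∪ Y belong to X, or all of them belong to Y; (v) for every edge uv of G with u, v ∈ B, there do not exist two distinct vertices x₁, x₂ ∈ X with ux₁, vx₂ ∈ E(G), and there do not exist two distinct vertices y₁, y₂ ∈ Y with uy₁, vy₂ ∈ E(G); (vi) for every path uwv of G with u, w, v ∈ B such that w has at most one neighbor in X ∪ Y, there do not exist x ∈ X and y ∈ Y such that (uy ∈ E(G) and vx ∈ E(G)) or (ux ∈ E(G) and vy ∈ E(G)). -/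

import Mathlib

/-- A graph `G` is `Cₘ`-free if it contains no subgraph isomorphic to the cycle of length `m`. -/
def CycleFree {V : Type*} (G : SimpleGraph V) (m : ℕ) : Prop :=
  ∀ f : SimpleGraph.cycleGraph m →g G, ¬ Function.Injective f

section DenseGraphs

open Finset

set_option linter.unusedSectionVars false

/-- `HasPath G F ℓ a b` : there is a path of length `ℓ` from `a` to `b` in `G` avoiding `F`. -/
def HasPath {V : Type*} (G : SimpleGraph V) (F : Finset V) (ℓ : ℕ) (a b : V) : Prop :=
  ∃ p : G.Walk a b, p.IsPath ∧ p.length = ℓ ∧ ∀ z ∈ p.support, z ∉ F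

section Paths

variable {V : Type*} {G : SimpleGraph V} {F : Finset V} {ℓ : ℕ} {a b c : V}

theorem HasPath.refl (ha : a ∉ F) : HasPath G F 0 a a :=
  ⟨.nil, by simp, by simp, by simpa using ha⟩

theorem HasPath.symm (h : HasPath G F ℓ a b) : HasPath G F ℓ b a := by
  obtain ⟨p, h1, h2, h3⟩ := h
  exact ⟨p.reverse, h1.reverse, by simpa using h2, by simpa using h3⟩

theorem HasPath.cons [DecidableEq V] (h : HasPath G (insert a F) ℓ c b) (hac : G.Adj a c)
    (ha : a ∉ F) : HasPath G F (ℓ + 1) a b := by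
  obtain ⟨p, h1, h2, h3⟩ := h
  refine ⟨.cons hac p, ?_, by simpa using h2, ?_⟩
  · rw [SimpleGraph.Walk.cons_isPath_iff]
    exact ⟨h1, fun h => h3 a h (mem_insert_self _ _)⟩
  · intro z hz
    rw [SimpleGraph.Walk.support_cons, List.mem_cons] at hz
    rcases hz with rfl | hz
    · exact ha
    · exact fun h => h3 z hz (mem_insert_of_mem h)

theorem HasPath.concat [DecidableEq V] (h : HasPath G (insert b F) ℓ a c) (hcb : G.Adj c b)
    (hb : b ∉ F) : HasPath G F (ℓ + 1) a b :=
  (h.symm.cons hcb.symm hb).symm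

theorem HasPath.not_cycleFree (h : HasPath G F ℓ a b) (hab : G.Adj b a) :
    ¬ CycleFree G (ℓ + 1) := by
  obtain ⟨p, h1, h2, -⟩ := h
  intro hfree
  have key : ∀ u v : Fin (ℓ + 1), (u - v).val = 1 → G.Adj (p.getVert u) (p.getVert v) := by
    intro u v huv
    by_cases hvu : v ≤ u
    · rw [Fin.sub_val_of_le hvu] at huv
      have : (u : ℕ) = v + 1 := by have : (v : ℕ) ≤ u := hvu; omega
      rw [this]
      exact (p.adj_getVert_succ (by omega)).symm
    · have hlt : (u : ℕ) < v := by simpa using hvu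
      rw [Fin.sub_def] at huv
      simp only at huv
      have h4 : (ℓ + 1 - (v : ℕ) + u) < ℓ + 1 := by omega
      rw [Nat.mod_eq_of_lt h4] at huv
      have hu : (u : ℕ) = 0 := by omega
      have hv : (v : ℕ) = p.length := by omega
      rw [hu, hv, p.getVert_zero, p.getVert_length]
      exact hab.symm
  refine hfree ⟨fun i => p.getVert i, ?_⟩ ?_
  · intro u v huv
    rw [SimpleGraph.cycleGraph_adj'] at huv
    rcases huv with h | h
    · exact key u v h
    · exact (key v u h).symm
  · intro u v huv
    have := h1.getVert_injOn (by simp; omega) (by simp; omega) huv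
    exact Fin.ext this

/-- Even paths between vertices of a set whose pairs have many common neighbours. -/
theorem hasPath_even_of_linked [Fintype V] [DecidableEq V] [DecidableRel G.Adj] {A : Finset V}
    {q : ℕ} (hA : q ≤ #A)
    (hlink : ∀ x ∈ A, ∀ y ∈ A, x ≠ y → q ≤ #{z | G.Adj x z ∧ G.Adj y z}) (j : ℕ) :
    ∀ (F : Finset V) (a b : V), a ∈ A → b ∈ A → a ≠ b → a ∉ F → b ∉ F →
      #F + 2 * j + 2 < q → HasPath G F (2 * j + 2) a b := by
  induction j with
  | zero =>
    intro F a b ha hb hab haF hbF hq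
    obtain ⟨z, hz, hzF⟩ := exists_mem_notMem_of_card_lt_card
      (show #F < #{z | G.Adj a z ∧ G.Adj b z} by have := hlink a ha b hb hab; omega)
    simp only [mem_filter, mem_univ, true_and] at hz
    refine HasPath.cons (c := z) (HasPath.cons (c := b) (HasPath.refl ?_) hz.2.symm ?_) hz.1 haF
    · simp [hz.2.ne, hab.symm, hbF]
    · simp [hz.1.ne', hzF]
  | succ j ih =>
    intro F a b ha hb hab haF hbF hq
    obtain ⟨a', ha', haF'⟩ := exists_mem_notMem_of_card_lt_card
      (show #(insert a (insert b F)) < #A by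
        have h1 := card_insert_le a (insert b F)
        have h2 := card_insert_le b F
        omega)
    simp only [mem_insert, not_or] at haF'
    obtain ⟨z, hz, hzF⟩ := exists_mem_notMem_of_card_lt_card
      (show #(insert b F) < #{z | G.Adj a z ∧ G.Adj a' z} by
        have := hlink a ha a' ha' (Ne.symm haF'.1)
        have h2 := card_insert_le b F
        omega)
    simp only [mem_filter, mem_univ, true_and] at hz
    simp only [mem_insert, not_or] at hzF
    refine HasPath.cons (c := z) (HasPath.cons (c := a')
      (ih (insert z (insert a F)) a' b ha' hb haF'.2.1 ?_ ?_ ?_) hz.2.symm ?_) hz.1 haF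
    · simp [haF', hz.2.ne]
    · simp [Ne.symm hzF.1, hab.symm, hbF]
    · have h1 := card_insert_le z (insert a F)
      have h2 := card_insert_le a F
      omega
    · simp [hz.1.ne', hzF]

/-- A list of vertices whose consecutive members have many common neighbours can be completed
to a path. -/
theorem hasPath_of_isChain [Fintype V] [DecidableEq V] [DecidableRel G.Adj] {q : ℕ}
    (l : List V) :
    ∀ (F : Finset V) (a : V),
      (a :: l).IsChain (fun x y => q ≤ #{z | G.Adj x z ∧ G.Adj y z}) →
      (a :: l).Nodup → (∀ z ∈ a :: l, z ∉ F) → #F + 2 * l.length + 1 ≤ q →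
      ∃ b ∈ a :: l, HasPath G F (2 * l.length) a b := by
  induction l with
  | nil =>
    intro F a _ _ hF _
    exact ⟨a, by simp, HasPath.refl (hF a (by simp))⟩
  | cons b l ih =>
    intro F a hc hn hF hq
    rw [List.isChain_cons_cons] at hc
    rw [List.nodup_cons] at hn
    simp only [List.length_cons] at hq
    obtain ⟨z, hz, hzF⟩ := exists_mem_notMem_of_card_lt_card
      (show #(F ∪ (b :: l).toFinset) < #{z | G.Adj a z ∧ G.Adj b z} by
        have h1 := card_union_le F (b :: l).toFinset
        have h2 := List.toFinset_card_le (b :: l)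
        simp only [List.length_cons] at h2
        omega)
    simp only [mem_filter, mem_univ, true_and] at hz
    simp only [mem_union, List.mem_toFinset, not_or] at hzF
    obtain ⟨c, hc, hp⟩ := ih (insert z (insert a F)) b hc.2 hn.2 (by
        intro w hw
        simp only [mem_insert, not_or]
        refine ⟨?_, ?_, hF w (List.mem_cons_of_mem _ hw)⟩
        · rintro rfl; exact hzF.2 hw
        · rintro rfl; exact hn.1 hw) (by
        have h1 := card_insert_le z (insert a F)
        have h2 := card_insert_le a F
        omega)
    refine ⟨c, List.mem_cons_of_mem _ hc, ?_⟩
    have hz' : z ∉ insert a F := by simp [hz.1.ne', hzF.1]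
    exact HasPath.cons (hp.cons hz.2.symm hz') hz.1 (hF a (by simp))

/-- Two lists chained by a symmetric relation without independent triples cover any finite
set. -/
theorem exists_two_chains [DecidableEq V] {r : V → V → Prop} (hs : ∀ x y, r x y → r y x)
    (W : Finset V)
    (h3 : ∀ x ∈ W, ∀ y ∈ W, ∀ z ∈ W, x ≠ y → x ≠ z → y ≠ z → r x y ∨ r x z ∨ r y z) :
    ∃ l₁ l₂ : List V, l₁.IsChain r ∧ l₂.IsChain r ∧ (l₁ ++ l₂).Nodup ∧
      (∀ z, z ∈ l₁ ++ l₂ ↔ z ∈ W) := by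
  induction W using Finset.induction_on with
  | empty => exact ⟨[], [], by simp⟩
  | insert v W hv ih =>
    obtain ⟨l₁, l₂, hc₁, hc₂, hn, hm⟩ := ih (fun x hx y hy z hz => h3 x (mem_insert_of_mem hx)
      y (mem_insert_of_mem hy) z (mem_insert_of_mem hz))
    have hv' : v ∉ l₁ ++ l₂ := fun h => hv ((hm v).1 h)
    rcases l₁ with _ | ⟨p, l₁⟩
    · refine ⟨[v], l₂, by simp, hc₂, ?_, ?_⟩
      · simpa using ⟨hv', hn⟩
      · intro z; have := hm z; simp at this ⊢; tauto
    rcases l₂ with _ | ⟨q, l₂⟩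
    · refine ⟨p :: l₁, [v], hc₁, by simp, ?_, ?_⟩
      · rw [List.nodup_append_comm]
        simp only [List.append_nil] at hv' hn
        simpa using ⟨by simpa using hv', by simpa using hn⟩
      · intro z; have := hm z; simp at this ⊢; tauto
    have hpW : p ∈ W := (hm p).1 (by simp)
    have hqW : q ∈ W := (hm q).1 (by simp)
    have hpq : p ≠ q := by
      rintro rfl
      rw [List.nodup_append] at hn
      exact hn.2.2 p (by simp) p (by simp) rfl
    rcases h3 v (mem_insert_self _ _) p (mem_insert_of_mem hpW) q (mem_insert_of_mem hqW)
      (by rintro rfl; exact hv hpW) (by rintro rfl; exact hv hqW) hpq with h | h | h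
    · refine ⟨v :: p :: l₁, q :: l₂, List.isChain_cons_cons.2 ⟨h, hc₁⟩, hc₂, ?_, ?_⟩
      · rw [List.cons_append, List.nodup_cons]; exact ⟨hv', hn⟩
      · intro z
        rw [List.cons_append, List.mem_cons, hm, mem_insert]
    · refine ⟨p :: l₁, v :: q :: l₂, hc₁, List.isChain_cons_cons.2 ⟨h, hc₂⟩, ?_, ?_⟩
      · rw [List.nodup_middle]; rw [List.nodup_cons]; exact ⟨hv', hn⟩
      · intro z
        rw [List.perm_middle.mem_iff, List.mem_cons, hm, mem_insert]
    · refine ⟨(p :: l₁).reverse ++ (q :: l₂), [v], ?_, by simp, ?_, ?_⟩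
      · refine List.IsChain.append ?_ hc₂ ?_
        · rw [List.isChain_reverse]
          exact hc₁.imp (fun x y => hs x y)
        · simpa using h
      · rw [List.nodup_append_comm, List.singleton_append, List.nodup_cons]
        have hperm : ((p :: l₁).reverse ++ q :: l₂).Perm (p :: l₁ ++ q :: l₂) :=
          (List.reverse_perm _).append_right _
        exact ⟨fun h => hv' (hperm.mem_iff.1 h), hperm.nodup_iff.2 hn⟩
      · intro z
        have hperm : ((p :: l₁).reverse ++ q :: l₂).Perm (p :: l₁ ++ q :: l₂) :=
          (List.reverse_perm _).append_right _
        rw [List.mem_append, hperm.mem_iff, hm, mem_insert, List.mem_singleton, or_comm]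

end Paths

section Degrees

variable {V : Type*} [Fintype V] [DecidableEq V] (G : SimpleGraph V) [DecidableRel G.Adj]

/-- The number of neighbours of `v` in `U`. -/
def degIn (U : Finset V) (v : V) : ℕ := #{w ∈ U | G.Adj v w}

/-- The number of ordered pairs of adjacent vertices in `X × Y`. -/
def pairsIn (X Y : Finset V) : ℕ := ∑ v ∈ X, degIn G Y v

theorem degIn_le_card (U : Finset V) (v : V) : degIn G U v ≤ #U := card_filter_le _ _

theorem degIn_eq_sum (U : Finset V) (v : V) :
    degIn G U v = ∑ w ∈ U, if G.Adj v w then 1 else 0 := by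
  rw [degIn, card_filter]

theorem pairsIn_comm (X Y : Finset V) : pairsIn G X Y = pairsIn G Y X := by
  simp only [pairsIn, degIn_eq_sum]
  rw [sum_comm]
  simp only [G.adj_comm]

theorem degIn_union {X Y : Finset V} (h : Disjoint X Y) (v : V) :
    degIn G (X ∪ Y) v = degIn G X v + degIn G Y v := by
  simp only [degIn_eq_sum, sum_union h]

theorem pairsIn_union_left {X Y : Finset V} (h : Disjoint X Y) (Z : Finset V) :
    pairsIn G (X ∪ Y) Z = pairsIn G X Z + pairsIn G Y Z := by
  simp only [pairsIn, sum_union h]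

theorem pairsIn_union_right {X Y : Finset V} (h : Disjoint X Y) (Z : Finset V) :
    pairsIn G Z (X ∪ Y) = pairsIn G Z X + pairsIn G Z Y := by
  simp only [pairsIn, degIn_union G h, sum_add_distrib]

theorem pairsIn_le_mul (X Y : Finset V) : pairsIn G X Y ≤ #X * #Y := by
  rw [← smul_eq_mul]
  exact sum_le_card_nsmul _ _ _ fun v _ => degIn_le_card G Y v

theorem pairsIn_eq_zero {X Y : Finset V} (h : ∀ x ∈ X, ∀ y ∈ Y, ¬ G.Adj x y) :
    pairsIn G X Y = 0 := by
  refine sum_eq_zero fun x hx => ?_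
  rw [degIn, card_eq_zero, filter_eq_empty_iff]
  exact fun y hy => h x hx y hy

theorem pairsIn_univ : pairsIn G univ univ = 2 * #G.edgeFinset := by
  rw [← G.sum_degrees_eq_twice_card_edges]
  refine sum_congr rfl fun v _ => ?_
  rw [degIn, ← G.card_neighborFinset_eq_degree, G.neighborFinset_eq_filter]

theorem degIn_univ (v : V) : degIn G univ v = G.degree v := by
  rw [degIn, ← G.card_neighborFinset_eq_degree, G.neighborFinset_eq_filter]

theorem degree_le_degIn_add (U : Finset V) (v : V) : G.degree v ≤ degIn G U v + #Uᶜ := by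
  rw [← degIn_univ, ← union_compl U, degIn_union G disjoint_compl_right]
  have := degIn_le_card G Uᶜ v
  omega

theorem pairsIn_erase {U : Finset V} {v : V} (hv : v ∈ U) :
    pairsIn G (U.erase v) (U.erase v) + 2 * degIn G U v = pairsIn G U U := by
  have hd : Disjoint {v} (U.erase v) := by simp
  have hU : {v} ∪ U.erase v = U := by
    rw [← insert_eq, insert_erase hv]
  have h1 : degIn G {v} v = 0 := by
    rw [degIn, card_eq_zero, filter_eq_empty_iff]
    simp
  have h2 : pairsIn G U U = pairsIn G ({v} ∪ U.erase v) ({v} ∪ U.erase v) := by rw [hU]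
  have h3 : degIn G U v = degIn G ({v} ∪ U.erase v) v := by rw [hU]
  rw [pairsIn_union_left G hd, pairsIn_union_right G hd, pairsIn_union_right G hd,
    pairsIn_comm G (U.erase v) {v}] at h2
  rw [degIn_union G hd, h1] at h3
  have h4 : ∀ Z, pairsIn G {v} Z = degIn G Z v := fun Z => by simp [pairsIn]
  rw [h4, h4, h1] at h2
  omega

/-- A vertex set of large minimum degree obtained by maximising an energy. -/
theorem exists_dense_core : ∃ U : Finset V,
    (∀ v ∈ U, 2 * #U < 5 * degIn G U v) ∧
    10 * #G.edgeFinset + 2 * #U ^ 2 + 4 * #U ≤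
      5 * pairsIn G U U + 2 * Fintype.card V ^ 2 + 4 * Fintype.card V := by
  obtain ⟨U, -, hU⟩ := exists_max_image (univ : Finset (Finset V))
    (fun U => (5 * pairsIn G U U - 2 * #U ^ 2 - 4 * #U : ℤ)) ⟨∅, mem_univ _⟩
  refine ⟨U, fun v hv => ?_, ?_⟩
  · have h1 := hU (U.erase v) (mem_univ _)
    have h2 := pairsIn_erase G hv
    have h3 : (#(U.erase v) : ℤ) = #U - 1 := by
      rw [card_erase_of_mem hv, Nat.cast_sub (card_pos.2 ⟨v, hv⟩)]; simp
    rw [h3] at h1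
    zify at h2 ⊢
    nlinarith
  · have h1 := hU univ (mem_univ _)
    rw [pairsIn_univ, card_univ] at h1
    zify
    push_cast at h1
    linarith

variable {G}

theorem not_cycleFree_of_triangle {U : Finset V} {k : ℕ} (hk : 2 ≤ k) (hm : 90 * k ≤ #U)
    (hdeg : ∀ v ∈ U, 2 * #U < 5 * degIn G U v) {a b c : V} (ha : a ∈ U) (hb : b ∈ U)
    (hc : c ∈ U) (hab : G.Adj a b) (hac : G.Adj a c) (hbc : G.Adj b c) :
    ¬ CycleFree G (2 * k + 1) := by
  have common : ∀ x ∈ U, ∀ y ∈ U, ∀ z ∈ U, (6 * k ≤ #{w ∈ U | G.Adj x w ∧ G.Adj y w}) ∨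
      (6 * k ≤ #{w ∈ U | G.Adj x w ∧ G.Adj z w}) ∨
      (6 * k ≤ #{w ∈ U | G.Adj y w ∧ G.Adj z w}) := by
    intro x hx y hy z hz
    have hx' := hdeg x hx
    have hy' := hdeg y hy
    have hz' := hdeg z hz
    have key : degIn G U x + degIn G U y + degIn G U z ≤ #U +
        #{w ∈ U | G.Adj x w ∧ G.Adj y w} + #{w ∈ U | G.Adj x w ∧ G.Adj z w} +
        #{w ∈ U | G.Adj y w ∧ G.Adj z w} := by
      rw [degIn, degIn, degIn, card_eq_sum_ones U, card_filter, card_filter, card_filter,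
        card_filter, card_filter, card_filter]
      simp only [← sum_add_distrib]
      refine sum_le_sum fun w _ => ?_
      by_cases h1 : G.Adj x w <;> by_cases h2 : G.Adj y w <;> by_cases h3 : G.Adj z w <;>
        simp [h1, h2, h3]
    omega
  have main : ∀ x y : V, G.Adj x y → 6 * k ≤ #{w ∈ U | G.Adj x w ∧ G.Adj y w} →
      ¬ CycleFree G (2 * k + 1) := by
    intro x y hxy hW
    set W : Finset V := {w ∈ U | G.Adj x w ∧ G.Adj y w} with hWdef
    have hWm : ∀ w ∈ W, w ∈ U ∧ G.Adj x w ∧ G.Adj y w := fun w hw => by simpa [W] using hw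
    have hsub : ∀ u v : V, #{w ∈ U | G.Adj u w ∧ G.Adj v w} ≤ #{w | G.Adj u w ∧ G.Adj v w} :=
      fun u v => card_le_card (filter_subset_filter _ (subset_univ U))
    obtain ⟨l₁, l₂, hc₁, hc₂, hn, hmem⟩ := exists_two_chains
      (r := fun u v => 6 * k ≤ #{w | G.Adj u w ∧ G.Adj v w})
      (by intro u v h; simpa only [and_comm] using h) W (by
        intro u hu v hv w hw _ _ _
        rcases common u (hWm u hu).1 v (hWm v hv).1 w (hWm w hw).1 with h | h | h
        · exact Or.inl (h.trans (hsub _ _))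
        · exact Or.inr (Or.inl (h.trans (hsub _ _)))
        · exact Or.inr (Or.inr (h.trans (hsub _ _))))
    have hlen : 6 * k ≤ l₁.length + l₂.length := by
      rw [← List.length_append, ← List.toFinset_card_of_nodup hn]
      refine hW.trans (card_le_card fun z hz => ?_)
      rw [List.mem_toFinset]; exact (hmem z).2 hz
    obtain ⟨l, hl, hlc, hln, hlW⟩ : ∃ l : List V, k ≤ l.length ∧
        l.IsChain (fun u v => 6 * k ≤ #{w | G.Adj u w ∧ G.Adj v w}) ∧ l.Nodup ∧
        ∀ z ∈ l, z ∈ W := by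
      rw [List.nodup_append] at hn
      by_cases h : k ≤ l₁.length
      · exact ⟨l₁, h, hc₁, hn.1, fun z hz => (hmem z).1 (List.mem_append_left _ hz)⟩
      · exact ⟨l₂, by omega, hc₂, hn.2.1, fun z hz => (hmem z).1 (List.mem_append_right _ hz)⟩
    have hsl : (l.take k).Sublist l := List.take_sublist _ _
    have hlk : (l.take k).length = k := by simp [hl]
    have hc' := hlc.take k
    have hn' := hln.sublist hsl
    have hW' : ∀ z ∈ l.take k, z ∈ W := fun z hz => hlW z (hsl.subset hz)
    rcases hL : l.take k with _ | ⟨w, l'⟩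
    · rw [hL] at hlk; simp at hlk; omega
    rw [hL] at hlk hc' hn' hW'
    simp only [List.length_cons] at hlk
    have hne : ∀ z ∈ w :: l', z ∉ ({y, x} : Finset V) := by
      intro z hz
      have := hWm z (hW' z hz)
      simp [this.2.1.ne', this.2.2.ne']
    obtain ⟨c, hc, hp⟩ := hasPath_of_isChain l' {y, x} w hc' hn' hne (by
      have := card_le_two (a := y) (b := x)
      omega)
    have hxw := (hWm w (hW' w (by simp))).2.1
    have hyc := (hWm c (hW' c hc)).2.2
    have hp2 : HasPath G {x} (2 * l'.length + 1) w y := by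
      refine HasPath.concat hp hyc.symm ?_
      simpa using hxy.ne'
    have hp3 : HasPath G ∅ (2 * l'.length + 1 + 1) x y :=
      HasPath.cons (by simpa using hp2) hxw (by simp)
    have := hp3.not_cycleFree hxy.symm
    rwa [show 2 * l'.length + 1 + 1 + 1 = 2 * k + 1 by omega] at this
  rcases common a ha b hb c hc with h | h | h
  · exact main a b hab h
  · exact main a c hac h
  · exact main b c hbc h

/-- A dense core of a graph without `C_{2k+1}` is bipartite, and each of its two sides is
well linked. -/
theorem exists_bipartition_of_dense {U : Finset V} {k : ℕ} (hk : 2 ≤ k) (hm : 90 * k ≤ #U)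
    (hdeg : ∀ v ∈ U, 2 * #U < 5 * degIn G U v) (hfree : CycleFree G (2 * k + 1)) :
    ∃ X Y : Finset V, Disjoint X Y ∧ X ∪ Y = U ∧
      (∀ x ∈ X, ∀ y ∈ X, ¬ G.Adj x y) ∧ (∀ x ∈ Y, ∀ y ∈ Y, ¬ G.Adj x y) := by
  have hne : Nonempty U := by
    rw [nonempty_coe_sort, ← card_pos]; omega
  have hcol : (G.induce (U : Set V)).Colorable 2 := by
    refine SimpleGraph.colorable_of_cliqueFree_lt_minDegree (r := 2) ?_ ?_
    · intro s hs
      obtain ⟨a, b, c, hab, hac, hbc, -⟩ := SimpleGraph.is3Clique_iff.1 hs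
      exact not_cycleFree_of_triangle hk hm hdeg a.2 b.2 c.2 hab hac hbc hfree
    · have : Nonempty ((U : Set V) : Type _) := hne
      obtain ⟨v, hv⟩ := (G.induce (U : Set V)).exists_minimal_degree_vertex
      rw [hv]
      have h1 : (G.induce (U : Set V)).degree v = degIn G U v := by
        rw [← SimpleGraph.card_neighborFinset_eq_degree, degIn,
          ← card_map (Function.Embedding.subtype _)]
        congr 1
        ext w
        simp [and_comm]
      have h2 := hdeg v v.2
      rw [h1]
      have h3 : Fintype.card ((U : Set V) : Type _) = #U := by simp
      rw [h3, Nat.div_lt_iff_lt_mul (by norm_num)]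
      omega
  obtain ⟨C⟩ := hcol
  refine ⟨{v ∈ U | ∃ h : v ∈ (U : Set V), C ⟨v, h⟩ = 0},
    {v ∈ U | ∃ h : v ∈ (U : Set V), C ⟨v, h⟩ = 1}, ?_, ?_, ?_, ?_⟩
  · rw [disjoint_left]
    intro v h1 h2
    obtain ⟨-, h, h1⟩ := mem_filter.1 h1
    obtain ⟨-, _, h2⟩ := mem_filter.1 h2
    rw [h1] at h2
    exact absurd h2 (by decide)
  · ext v
    simp only [mem_union, mem_filter]
    refine ⟨by tauto, fun h => ?_⟩
    have : ∀ i : Fin 2, i = 0 ∨ i = 1 := by decide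
    rcases this (C ⟨v, h⟩) with h0 | h0
    · exact Or.inl ⟨h, h, h0⟩
    · exact Or.inr ⟨h, h, h0⟩
  all_goals
    intro x hx y hy hxy
    obtain ⟨-, h, h1⟩ := mem_filter.1 hx
    obtain ⟨-, h', h2⟩ := mem_filter.1 hy
    exact C.valid (v := ⟨x, h⟩) (w := ⟨y, h'⟩) hxy (h1.trans h2.symm)

end Degrees

section Pairs

variable {V : Type*} [Fintype V] [DecidableEq V] {G : SimpleGraph V} [DecidableRel G.Adj]

theorem exists_adj_notMem {U F : Finset V} {v : V} (h : #F < degIn G U v) :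
    ∃ w ∈ U, G.Adj v w ∧ w ∉ F := by
  obtain ⟨w, hw, hF⟩ := exists_mem_notMem_of_card_lt_card h
  rw [mem_filter] at hw
  exact ⟨w, hw.1, hw.2, hF⟩

variable (G) in
/-- Two independent sets between which `G` is so dense that any two vertices of one of them have
at least `q` common neighbours. -/
structure LinkedPair (q : ℕ) (X Y : Finset V) : Prop where
  disj : Disjoint X Y
  indep_left : ∀ x ∈ X, ∀ y ∈ X, ¬ G.Adj x y
  indep_right : ∀ x ∈ Y, ∀ y ∈ Y, ¬ G.Adj x y
  link_left : ∀ x ∈ X, ∀ y ∈ X, x ≠ y → q ≤ #{z | G.Adj x z ∧ G.Adj y z}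
  link_right : ∀ x ∈ Y, ∀ y ∈ Y, x ≠ y → q ≤ #{z | G.Adj x z ∧ G.Adj y z}
  deg_left : ∀ x ∈ X, q ≤ degIn G Y x
  deg_right : ∀ x ∈ Y, q ≤ degIn G X x
  card_left : q ≤ #X
  card_right : q ≤ #Y

theorem LinkedPair.symm {q : ℕ} {X Y : Finset V} (h : LinkedPair G q X Y) :
    LinkedPair G q Y X :=
  ⟨h.disj.symm, h.indep_right, h.indep_left, h.link_right, h.link_left, h.deg_right,
    h.deg_left, h.card_right, h.card_left⟩

theorem LinkedPair.hasPath_odd {q : ℕ} {X Y : Finset V} (h : LinkedPair G q X Y) {x y : V}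
    (hx : x ∈ X) (hy : y ∈ Y) {F : Finset V} (hxF : x ∉ F) (hyF : y ∉ F) {j : ℕ}
    (hq : #F + 2 * j + 3 < q) : HasPath G F (2 * j + 3) x y := by
  have hxy : x ≠ y := fun e => disjoint_left.1 h.disj hx (e ▸ hy)
  have h1 := card_insert_le y F
  have h2 := card_insert_le x F
  obtain ⟨z, hz, hxz, hzF⟩ := exists_adj_notMem (G := G) (F := insert y F) (v := x) (U := Y)
    (by have := h.deg_left x hx; omega)
  rw [mem_insert, not_or] at hzF
  refine HasPath.cons (c := z) ?_ hxz hxF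
  refine hasPath_even_of_linked h.card_right h.link_right j _ z y hz hy hzF.1 ?_ ?_ (by omega)
  · simp [hxz.ne', hzF.2]
  · simp [hxy.symm, hyF]

theorem LinkedPair.not_adj_both {k : ℕ} (hk : 2 ≤ k) {X Y : Finset V}
    (h : LinkedPair G (9 * k) X Y) (hfree : CycleFree G (2 * k + 1)) {v x y : V} (hx : x ∈ X)
    (hy : y ∈ Y) (hvx : G.Adj v x) (hvy : G.Adj v y) : False := by
  have hp : HasPath G {v} (2 * (k - 2) + 3) x y :=
    h.hasPath_odd hx hy (by simpa using hvx.ne') (by simpa using hvy.ne')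
      (by rw [card_singleton]; omega)
  have hp2 : HasPath G ∅ (2 * (k - 2) + 3 + 1) v y :=
    HasPath.cons (by simpa using hp) hvx (by simp)
  have := hp2.not_cycleFree hvy.symm
  rw [show 2 * (k - 2) + 3 + 1 + 1 = 2 * k + 1 by omega] at this
  exact this hfree

theorem LinkedPair.not_adj_of_adj_right {k : ℕ} (hk : 2 ≤ k) {X Y : Finset V}
    (h : LinkedPair G (9 * k) X Y) (hfree : CycleFree G (2 * k + 1)) {u v y z : V}
    (hy : y ∈ Y) (hz : z ∈ Y) (hyz : y ≠ z) (huz : u ≠ z) (hvy : v ≠ y)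
    (huy : G.Adj u y) (hvz : G.Adj v z) : ¬ G.Adj u v := by
  intro huv
  have h2 := card_le_two (a := u) (b := v)
  have hp : HasPath G {u, v} (2 * (k - 2) + 2) y z :=
    hasPath_even_of_linked h.card_right h.link_right _ _ y z hy hz hyz
      (by simp [huy.ne', hvy.symm]) (by simp [hvz.ne', huz.symm]) (by omega)
  have hp1 : HasPath G {v} (2 * (k - 2) + 2 + 1) u z :=
    HasPath.cons hp huy (by simpa using huv.ne)
  have hp2 : HasPath G ∅ (2 * (k - 2) + 2 + 1 + 1) v u :=
    HasPath.cons (by simpa using hp1.symm) hvz (by simp)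
  have := hp2.not_cycleFree huv
  rw [show 2 * (k - 2) + 2 + 1 + 1 + 1 = 2 * k + 1 by omega] at this
  exact this hfree

variable (G) in
/-- A bipartition `X`, `Y` of the complement of `B` whose vertices are well attached to a linked
pair `X₀`, `Y₀`. -/
structure GoodPartition (k : ℕ) (B X Y X₀ Y₀ : Finset V) : Prop where
  linked : LinkedPair G (9 * k) X₀ Y₀
  disj : Disjoint X Y
  union : X ∪ Y = Bᶜ
  indep_left : ∀ x ∈ X, ∀ y ∈ X, ¬ G.Adj x y
  indep_right : ∀ x ∈ Y, ∀ y ∈ Y, ¬ G.Adj x y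
  core_left : ∀ x ∈ X, 29 ≤ degIn G Y₀ x
  core_right : ∀ y ∈ Y, 29 ≤ degIn G X₀ y
  deg_left : ∀ x ∈ X, 2 ≤ degIn G Y x
  deg_right : ∀ y ∈ Y, 2 ≤ degIn G X y
  edge : ∀ x ∈ X, ∀ y ∈ Y, ∃ y' ∈ Y, ∃ x' ∈ X, y' ≠ y ∧ x' ≠ x ∧
    G.Adj x y' ∧ G.Adj y' x' ∧ G.Adj x' y

namespace GoodPartition

variable {k : ℕ} {B X Y X₀ Y₀ : Finset V}

theorem symm (P : GoodPartition G k B X Y X₀ Y₀) : GoodPartition G k B Y X Y₀ X₀ where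
  linked := P.linked.symm
  disj := P.disj.symm
  union := by rw [union_comm, P.union]
  indep_left := P.indep_right
  indep_right := P.indep_left
  core_left := P.core_right
  core_right := P.core_left
  deg_left := P.deg_right
  deg_right := P.deg_left
  edge := by
    intro y hy x hx
    obtain ⟨y', hy', x', hx', h1, h2, h3, h4, h5⟩ := P.edge x hx y hy
    exact ⟨x', hx', y', hy', h2, h1, h5.symm, h4.symm, h3.symm⟩

theorem notMem_left (P : GoodPartition G k B X Y X₀ Y₀) {x : V} (hx : x ∈ X) : x ∉ B := by
  rw [← mem_compl, ← P.union]
  exact mem_union_left _ hx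

theorem notMem_right (P : GoodPartition G k B X Y X₀ Y₀) {y : V} (hy : y ∈ Y) : y ∉ B :=
  P.symm.notMem_left hy

theorem ne (P : GoodPartition G k B X Y X₀ Y₀) {x y : V} (hx : x ∈ X) (hy : y ∈ Y) : x ≠ y :=
  fun e => disjoint_left.1 P.disj hx (e ▸ hy)

theorem hasPath_odd (P : GoodPartition G k B X Y X₀ Y₀) {x y : V} (hx : x ∈ X) (hy : y ∈ Y)
    {F : Finset V} (hFB : F ⊆ B) (hF : #F ≤ 3) {j : ℕ} (hj : j + 2 ≤ k) :
    HasPath G F (2 * j + 3) x y := by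
  have hXF : ∀ z ∈ X, z ∉ F := fun z hz h => P.notMem_left hz (hFB h)
  have hYF : ∀ z ∈ Y, z ∉ F := fun z hz h => P.notMem_right hz (hFB h)
  have hxy := P.ne hx hy
  rcases j with _ | j
  · obtain ⟨y', hy', x', hx', h1, h2, h3, h4, h5⟩ := P.edge x hx y hy
    refine HasPath.cons (c := y') (HasPath.cons (c := x') (HasPath.cons (c := y)
      (HasPath.refl ?_) h5 ?_) h4 ?_) h3 (hXF x hx)
    · simp [h1.symm, hxy.symm, hYF y hy, h5.ne']
    · simp [h2, h4.ne', hXF x' hx']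
    · simp [h3.ne', hYF y' hy']
  · have c1 := card_insert_le x F
    have c2 := card_insert_le y (insert x F)
    obtain ⟨y', hy', h1, h1F⟩ := exists_adj_notMem (G := G) (F := insert y (insert x F))
      (v := x) (U := Y₀) (by have := P.core_left x hx; omega)
    obtain ⟨x', hx', h2, h2F⟩ := exists_adj_notMem (G := G) (F := insert y (insert x F))
      (v := y) (U := X₀) (by have := P.core_right y hy; omega)
    have hp := P.linked.symm.hasPath_odd hy' hx' h1F h2F (j := j) (by omega)
    have hp1 : HasPath G (insert x F) (2 * j + 3 + 1) y' y :=
      HasPath.concat hp h2.symm (by simp [hxy.symm, hYF y hy])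
    exact HasPath.cons hp1 h1 (hXF x hx)

theorem hasPath_even (P : GoodPartition G k B X Y X₀ Y₀) {x y : V} (hx : x ∈ X) (hy : y ∈ X)
    (hxy : x ≠ y) {F : Finset V} (hFB : F ⊆ B) (hF : #F ≤ 3) {j : ℕ} (hj : j + 2 ≤ k) :
    HasPath G F (2 * j + 4) x y := by
  have hXF : ∀ z ∈ X, z ∉ F := fun z hz h => P.notMem_left hz (hFB h)
  have c1 := card_insert_le x F
  have c2 := card_insert_le y (insert x F)
  obtain ⟨x', hx', h1, h1F⟩ := exists_adj_notMem (G := G) (F := insert y (insert x F))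
    (v := x) (U := Y₀) (by have := P.core_left x hx; omega)
  have c3 := card_insert_le x' (insert y (insert x F))
  obtain ⟨y', hy', h2, h2F⟩ := exists_adj_notMem (G := G) (F := insert x' (insert y (insert x F)))
    (v := y) (U := Y₀) (by have := P.core_left y hy; omega)
  rw [mem_insert, not_or] at h2F
  have hp := hasPath_even_of_linked P.linked.card_right P.linked.link_right j
    (insert y (insert x F)) x' y' hx' hy' (Ne.symm h2F.1) h1F h2F.2 (by omega)
  have hp1 : HasPath G (insert x F) (2 * j + 2 + 1) x' y :=
    HasPath.concat hp h2.symm (by simp [hxy.symm, hXF y hy])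
  exact HasPath.cons hp1 h1 (hXF x hx)

theorem not_adj_both (P : GoodPartition G k B X Y X₀ Y₀) (hk : 2 ≤ k)
    (hfree : CycleFree G (2 * k + 1)) {v x y : V} (hv : v ∈ B) (hx : x ∈ X) (hy : y ∈ Y)
    (hvx : G.Adj v x) (hvy : G.Adj v y) : False := by
  have hp : HasPath G {v} (2 * (k - 2) + 3) x y :=
    P.hasPath_odd hx hy (by simpa using hv) (by simp) (by omega)
  have hp2 : HasPath G ∅ (2 * (k - 2) + 3 + 1) v y :=
    HasPath.cons (by simpa using hp) hvx (by simp)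
  have := hp2.not_cycleFree hvy.symm
  rw [show 2 * (k - 2) + 3 + 1 + 1 = 2 * k + 1 by omega] at this
  exact this hfree

theorem not_adj_pair (P : GoodPartition G k B X Y X₀ Y₀) (hk : 3 ≤ k)
    (hfree : CycleFree G (2 * k + 1)) {u v x y : V} (hu : u ∈ B) (hv : v ∈ B) (hx : x ∈ X)
    (hy : y ∈ X) (hxy : x ≠ y) (hux : G.Adj u x) (hvy : G.Adj v y) : ¬ G.Adj u v := by
  intro huv
  have hp : HasPath G {u, v} (2 * (k - 3) + 4) x y :=
    P.hasPath_even hx hy hxy (by simp [insert_subset_iff, hu, hv])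
      (card_le_two.trans (by norm_num)) (by omega)
  have hp1 : HasPath G {v} (2 * (k - 3) + 4 + 1) u y :=
    HasPath.cons hp hux (by simpa using huv.ne)
  have hp2 : HasPath G ∅ (2 * (k - 3) + 4 + 1 + 1) v u :=
    HasPath.cons (by simpa using hp1.symm) hvy (by simp)
  have := hp2.not_cycleFree huv
  rw [show 2 * (k - 3) + 4 + 1 + 1 + 1 = 2 * k + 1 by omega] at this
  exact this hfree

theorem not_path_of_adj (P : GoodPartition G k B X Y X₀ Y₀) (hk : 3 ≤ k)
    (hfree : CycleFree G (2 * k + 1)) {u w v x y : V} (hu : u ∈ B) (hw : w ∈ B) (hv : v ∈ B)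
    (huv : u ≠ v) (hx : x ∈ X) (hy : y ∈ Y) (hux : G.Adj u x) (hvy : G.Adj v y)
    (huw : G.Adj u w) (hwv : G.Adj w v) : False := by
  have hp : HasPath G {u, v, w} (2 * (k - 3) + 3) x y :=
    P.hasPath_odd hx hy (by simp [insert_subset_iff, hu, hv, hw]) card_le_three (by omega)
  have hp1 : HasPath G {v, w} (2 * (k - 3) + 3 + 1) u y :=
    HasPath.cons hp hux (by simp [huv, huw.ne])
  have hp2 : HasPath G {w} (2 * (k - 3) + 3 + 1 + 1) v u :=
    HasPath.cons (hp1.symm) hvy (by simpa using hwv.ne')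
  have hp3 : HasPath G ∅ (2 * (k - 3) + 3 + 1 + 1 + 1) w u :=
    HasPath.cons (by simpa using hp2) hwv (by simp)
  have := hp3.not_cycleFree huw
  rw [show 2 * (k - 3) + 3 + 1 + 1 + 1 + 1 = 2 * k + 1 by omega] at this
  exact this hfree

end GoodPartition

end Pairs

section Numbers

/-- Numerical relations between the parameters, where `s` plays the role of `√(tn)`. -/
structure ParamBounds (k n t : ℕ) (s : ℝ) : Prop where
  two_le : 2 ≤ k
  one_le : (1 : ℝ) ≤ t
  le_n : (504 * t : ℝ) ≤ n
  k_le : 252 * k ≤ n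
  sq_eq : s ^ 2 = t * n
  t_le : 22 * t ≤ s
  s_le : 22 * s ≤ n
  s_mul_le : 6 * (s * (t + 2)) ≤ n

theorem paramBounds_sqrt {k n t : ℕ} (hk : 2 ≤ k) (ht1 : 1 ≤ t) (ht2 : t ≤ 2 * k - 2)
    (hn : 252 * t ^ 2 * k ≤ n) : ParamBounds k n t (Real.sqrt (t * n)) := by
  have ht : (1 : ℝ) ≤ t := by exact_mod_cast ht1
  have hkr : (2 : ℝ) ≤ k := by exact_mod_cast hk
  have htk : (t : ℝ) + 2 ≤ 2 * k := by
    have : t + 2 ≤ 2 * k := by omega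
    exact_mod_cast this
  have hnr : 252 * (t : ℝ) ^ 2 * k ≤ n := by exact_mod_cast hn
  have h504 : 504 * (t : ℝ) ^ 2 ≤ n := by nlinarith [sq_nonneg (t : ℝ)]
  have hs0 := Real.sqrt_nonneg ((t : ℝ) * n)
  have hsq : Real.sqrt (t * n) ^ 2 = t * n := Real.sq_sqrt (by positivity)
  set s := Real.sqrt (t * n)
  have h504' : 504 * (t : ℝ) ≤ n := by nlinarith
  refine ⟨hk, ht, h504', ?_, hsq, ?_, ?_, ?_⟩
  · have : 1 ≤ t ^ 2 := Nat.one_le_pow _ _ ht1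
    nlinarith
  · refine Real.le_sqrt_of_sq_le ?_
    nlinarith
  · refine abs_le_of_sq_le_sq' ?_ (by positivity) |>.2
    nlinarith
  · refine abs_le_of_sq_le_sq' ?_ (by positivity) |>.2
    have h1 : 126 * (t : ℝ) ^ 2 * (t + 2) ≤ n := by nlinarith [sq_nonneg (t : ℝ)]
    have h2 : 36 * ((t : ℝ) * (t + 2) ^ 2) ≤ n := by
      nlinarith [mul_nonneg (mul_nonneg (by linarith : (0 : ℝ) ≤ t) (by linarith : (0 : ℝ) ≤ t + 2))
        (by linarith : (0 : ℝ) ≤ t - 1)]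
    have h3 : (36 * ((t : ℝ) * (t + 2) ^ 2)) * n ≤ (n : ℝ) * n := by gcongr
    have h4 : (6 * (s * ((t : ℝ) + 2))) ^ 2 = 36 * (s ^ 2 * ((t : ℝ) + 2) ^ 2) := by ring
    rw [h4, hsq]
    linarith

theorem edge_bound_real {n t e : ℕ} (htn : t + 1 ≤ n)
    (hedge : (n - t - 1) ^ 2 / 4 + (t + 2).choose 2 ≤ e) :
    ((n : ℝ) - t - 1) ^ 2 + 2 * ((t + 2) * (t + 1)) ≤ 4 * e + 3 := by
  obtain ⟨N, rfl⟩ : ∃ N, n = N + t + 1 := ⟨n - t - 1, by omega⟩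
  have h1 : N + t + 1 - t - 1 = N := by omega
  rw [h1] at hedge
  have h2 : 2 * (t + 2).choose 2 = (t + 2) * (t + 1) := by
    rw [Nat.choose_two_right, Nat.mul_div_cancel']
    · rfl
    · exact (Nat.even_mul_pred_self (t + 2)).two_dvd
  have h3 : N ^ 2 + 2 * ((t + 2) * (t + 1)) ≤ 4 * e + 3 := by omega
  have h4 : (((N + t + 1 : ℕ) : ℝ) - t - 1) = N := by push_cast; ring
  rw [h4]
  exact_mod_cast h3

theorem core_large {n t m D e : ℝ} (ht : 1 ≤ t) (htn : 504 * t ≤ n)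
    (he : (n - t - 1) ^ 2 + 2 * ((t + 2) * (t + 1)) ≤ 4 * e + 3) (hm : 0 ≤ m)
    (hD : D ≤ m ^ 2) (h : 10 * e + 2 * m ^ 2 + 4 * m ≤ 5 * D + 2 * n ^ 2 + 4 * n) :
    39 * n ≤ 100 * m := by
  by_contra! hlt
  have h1 : (251 * n) ^ 2 ≤ (252 * (n - t - 1)) ^ 2 := by
    apply pow_le_pow_left₀ <;> linarith
  have h2 : (100 * m) ^ 2 ≤ (39 * n) ^ 2 := by
    apply pow_le_pow_left₀ <;> linarith
  have h3 : 504 * n ≤ n ^ 2 := by nlinarith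
  nlinarith

theorem core_cofinite {n t m D e : ℝ} (ht : 1 ≤ t) (htn : 504 * t ≤ n)
    (he : (n - t - 1) ^ 2 + 2 * ((t + 2) * (t + 1)) ≤ 4 * e + 3) (hm : 39 * n ≤ 100 * m)
    (hD : 2 * D ≤ m ^ 2) (h : 10 * e + 2 * m ^ 2 + 4 * m ≤ 5 * D + 2 * n ^ 2 + 4 * n) :
    n ≤ m + 15 * t := by
  by_contra! hlt
  have h1 : (n - 2 * t) ^ 2 ≤ (n - t - 1) ^ 2 := by
    apply pow_le_pow_left₀ <;> linarith
  have h2 : 0 ≤ (n - 15 * t - m) * (n - 15 * t + m - 8) :=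
    mul_nonneg (by linarith) (by linarith)
  nlinarith

theorem card_bad_bound {n t s b e E p q : ℝ} (ht : 1 ≤ t) (htn : 504 * t ≤ n)
    (hs : 6 * (s * (t + 2)) ≤ n) (hs0 : 0 ≤ s)
    (he : (n - t - 1) ^ 2 + 2 * ((t + 2) * (t + 1)) ≤ 4 * e + 3)
    (hE : e ≤ E + 2 * s * b) (hpq : p + q + b = n) (hEpq : E ≤ p * q) (hb : b ≤ 15 * t) :
    b < t + 2 := by
  by_contra! hlt
  have h1 : 4 * E ≤ (n - b) ^ 2 := by
    have : n - b = p + q := by linarith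
    rw [this]; nlinarith [sq_nonneg (p - q)]
  have h2 : (b - t - 1) * (2 * n - b - t - 1) ≤ 8 * s * b := by nlinarith
  have h3 : s * b ≤ s * ((t + 2) * (b - t - 1)) := by
    apply mul_le_mul_of_nonneg_left _ hs0
    nlinarith
  have h4 : (b - t - 1) * (2 * n - 18 * t) ≤ (b - t - 1) * (2 * n - b - t - 1) := by
    apply mul_le_mul_of_nonneg_left <;> linarith
  have h5 : (b - t - 1) * (6 * (s * (t + 2))) ≤ (b - t - 1) * n := by
    apply mul_le_mul_of_nonneg_left <;> linarith
  have h6 : 0 < (b - t - 1) * (n - 36 * t) := mul_pos (by linarith) (by linarith)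
  nlinarith

theorem missing_bound {n t s b e E p q : ℝ} (ht : 1 ≤ t) (hsn : 22 * s ≤ n) (hs0 : 0 ≤ s)
    (hsq : s ^ 2 = t * n)
    (he : (n - t - 1) ^ 2 + 2 * ((t + 2) * (t + 1)) ≤ 4 * e + 3)
    (hE : e ≤ E + 2 * s * b) (hpq : p + q + b = n) (hb0 : 0 ≤ b) (hb : b ≤ t + 1) :
    4 * (p * q) + (p - q) ^ 2 ≤ 4 * E + 4 * s ^ 2 := by
  have h1 : 4 * (p * q) + (p - q) ^ 2 = (n - b) ^ 2 := by
    have : n - b = p + q := by linarith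
    rw [this]; ring
  have h2 : (t + 1 - b) * (2 * n - b - t - 1) ≤ (t + 1 - b) * (2 * n) := by
    apply mul_le_mul_of_nonneg_left <;> linarith
  have h3 : 0 ≤ b * (n - 4 * s) := mul_nonneg hb0 (by linarith)
  have h4 : 0 ≤ (t - 1) * n := mul_nonneg (by linarith) (by linarith)
  nlinarith

theorem part_size_bound {n t s b p q E : ℝ} (hts : 22 * t ≤ s) (ht : 1 ≤ t)
    (hpq : p + q + b = n) (hb0 : 0 ≤ b) (hb : b ≤ t + 1) (hEpq : E ≤ p * q)
    (h : 4 * (p * q) + (p - q) ^ 2 ≤ 4 * E + 4 * s ^ 2) :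
    n / 2 - 2 * s ≤ p ∧ p ≤ n / 2 + 2 * s := by
  have h1 : (p - q) ^ 2 ≤ (2 * s) ^ 2 := by nlinarith
  have h2 := abs_le_of_sq_le_sq' h1 (by linarith)
  constructor <;> linarith [h2.1, h2.2]

theorem few_low_bound {n t s r b p q E x y : ℝ} (hts : 22 * t ≤ s) (ht : 1 ≤ t)
    (hr : r ^ 2 = 3 * s ^ 2) (hr0 : 0 ≤ r)
    (hpq : p + q + b = n) (hb : b ≤ t + 1) (hEpq : E ≤ p * q)
    (h : 4 * (p * q) + (p - q) ^ 2 ≤ 4 * E + 4 * s ^ 2) (hx : 0 ≤ x) (hy : 0 ≤ y)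
    (h1 : E ≤ (p - x) * q + x * (n / 2 - r)) (h2 : E ≤ (q - y) * p + y * (n / 2 - r)) :
    x + y ≤ 3 / 2 * s := by
  by_contra! hlt
  have hrs : 173 / 100 * s ≤ r := by
    refine abs_le_of_sq_le_sq' ?_ hr0 |>.2
    nlinarith [sq_nonneg s]
  obtain ⟨d, hd0, hd⟩ : ∃ d : ℝ, 0 ≤ d ∧ (p - q) ^ 2 = (2 * d) ^ 2 :=
    ⟨|p - q| / 2, by positivity, by rw [mul_div_cancel₀ _ (by norm_num), sq_abs]⟩
  have h3 := abs_le_of_sq_le_sq' hd.le (by linarith)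
  have hds : d ≤ s := by
    refine abs_le_of_sq_le_sq' ?_ (by linarith) |>.2
    nlinarith
  have h4 : x * (168 / 100 * s - d) ≤ x * (q - n / 2 + r) :=
    mul_le_mul_of_nonneg_left (by linarith) hx
  have h5 : y * (168 / 100 * s - d) ≤ y * (p - n / 2 + r) :=
    mul_le_mul_of_nonneg_left (by linarith) hy
  have h6 : (3 / 2 * s) * (168 / 100 * s - d) < (x + y) * (168 / 100 * s - d) :=
    mul_lt_mul_of_pos_right hlt (by linarith)
  nlinarith [sq_nonneg (d - 3 / 8 * s), sq_nonneg s]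

end Numbers

section Core

variable {V : Type*} [Fintype V] [DecidableEq V] {G : SimpleGraph V} [DecidableRel G.Adj]

theorem le_card_common {k m : ℕ} {Y : Finset V} {x z : V} (hm : 90 * k ≤ m)
    (hx : 2 * m < 5 * degIn G Y x) (hz : 2 * m < 5 * degIn G Y z) (hY : 5 * #Y < 3 * m) :
    9 * k ≤ #{w | G.Adj x w ∧ G.Adj z w} := by
  have h1 := card_union_add_card_inter {w ∈ Y | G.Adj x w} {w ∈ Y | G.Adj z w}
  have h2 : #({w ∈ Y | G.Adj x w} ∪ {w ∈ Y | G.Adj z w}) ≤ #Y :=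
    card_le_card (union_subset (filter_subset _ _) (filter_subset _ _))
  have h3 : #({w ∈ Y | G.Adj x w} ∩ {w ∈ Y | G.Adj z w}) ≤ #{w | G.Adj x w ∧ G.Adj z w} := by
    refine card_le_card fun w hw => ?_
    simp only [mem_inter, mem_filter] at hw
    simp [hw.1.2, hw.2.2]
  unfold degIn at hx hz
  omega

theorem linkedPair_of_dense {k : ℕ} {X Y : Finset V} (hm : 90 * k ≤ #(X ∪ Y)) (hk : 1 ≤ k)
    (hdeg : ∀ v ∈ X ∪ Y, 2 * #(X ∪ Y) < 5 * degIn G (X ∪ Y) v) (hXY : Disjoint X Y)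
    (hX : ∀ x ∈ X, ∀ y ∈ X, ¬ G.Adj x y) (hY : ∀ x ∈ Y, ∀ y ∈ Y, ¬ G.Adj x y) :
    LinkedPair G (9 * k) X Y := by
  have hzero : ∀ {Z : Finset V}, (∀ x ∈ Z, ∀ y ∈ Z, ¬ G.Adj x y) → ∀ x ∈ Z, degIn G Z x = 0 := by
    intro Z hZ x hx
    rw [degIn, card_eq_zero, filter_eq_empty_iff]
    exact fun y hy => hZ x hx y hy
  have h1 : ∀ x ∈ X, 2 * #(X ∪ Y) < 5 * degIn G Y x := by
    intro x hx
    have := hdeg x (mem_union_left _ hx)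
    rwa [degIn_union G hXY, hzero hX x hx, zero_add] at this
  have h2 : ∀ y ∈ Y, 2 * #(X ∪ Y) < 5 * degIn G X y := by
    intro y hy
    have := hdeg y (mem_union_right _ hy)
    rwa [degIn_union G hXY, hzero hY y hy, add_zero] at this
  have hc := card_union_of_disjoint hXY
  have h3 : ∀ x ∈ X, 2 * #(X ∪ Y) < 5 * #Y := fun x hx => by
    have := h1 x hx
    have := degIn_le_card G Y x
    omega
  have h4 : ∀ y ∈ Y, 2 * #(X ∪ Y) < 5 * #X := fun y hy => by
    have := h2 y hy
    have := degIn_le_card G X y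
    omega
  have hpos : 0 < #(X ∪ Y) := by omega
  obtain ⟨v, hv⟩ := card_pos.1 hpos
  obtain ⟨hX', hY'⟩ : 2 * #(X ∪ Y) < 5 * #X ∧ 2 * #(X ∪ Y) < 5 * #Y := by
    rcases mem_union.1 hv with hv | hv
    · have h5 := h3 v hv
      obtain ⟨w, hw⟩ := card_pos.1 (show 0 < #Y by omega)
      exact ⟨h4 w hw, h5⟩
    · have h5 := h4 v hv
      obtain ⟨w, hw⟩ := card_pos.1 (show 0 < #X by omega)
      exact ⟨h5, h3 w hw⟩
  exact
    { disj := hXY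
      indep_left := hX
      indep_right := hY
      link_left := fun x hx z hz _ => le_card_common hm (h1 x hx) (h1 z hz) (by omega)
      link_right := fun x hx z hz _ => le_card_common hm (h2 x hx) (h2 z hz) (by omega)
      deg_left := fun x hx => by have := h1 x hx; omega
      deg_right := fun x hx => by have := h2 x hx; omega
      card_left := by omega
      card_right := by omega }

theorem exists_linkedPair {k n t : ℕ} {s : ℝ} (P : ParamBounds k n t s)
    (hcard : Fintype.card V = n) (hfree : CycleFree G (2 * k + 1))
    (he : ((n : ℝ) - t - 1) ^ 2 + 2 * ((t + 2) * (t + 1)) ≤ 4 * #G.edgeFinset + 3) :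
    ∃ X Y : Finset V, LinkedPair G (9 * k) X Y ∧ #(X ∪ Y)ᶜ ≤ 15 * t ∧
      ∀ v ∈ X ∪ Y, 78 * n < 500 * degIn G (X ∪ Y) v := by
  obtain ⟨U, hdeg, hU⟩ := exists_dense_core G
  rw [hcard] at hU
  have hU' : (10 : ℝ) * #G.edgeFinset + 2 * (#U : ℝ) ^ 2 + 4 * #U ≤
      5 * pairsIn G U U + 2 * (n : ℝ) ^ 2 + 4 * n := by exact_mod_cast hU
  have hD : (pairsIn G U U : ℝ) ≤ (#U : ℝ) ^ 2 := by
    have := pairsIn_le_mul G U U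
    rw [← sq] at this
    exact_mod_cast this
  have hlarge : 39 * n ≤ 100 * #U := by
    have := core_large P.one_le P.le_n he (Nat.cast_nonneg #U) hD hU'
    exact_mod_cast this
  have hm : 90 * k ≤ #U := by
    have := P.k_le
    omega
  obtain ⟨X, Y, hXY, rfl, hX, hY⟩ := exists_bipartition_of_dense P.two_le hm hdeg hfree
  have hD2 : 2 * (pairsIn G (X ∪ Y) (X ∪ Y) : ℝ) ≤ (#(X ∪ Y) : ℝ) ^ 2 := by
    have h1 : pairsIn G (X ∪ Y) (X ∪ Y) = 2 * pairsIn G X Y := by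
      rw [pairsIn_union_left G hXY, pairsIn_union_right G hXY, pairsIn_union_right G hXY,
        pairsIn_eq_zero G hX, pairsIn_eq_zero G hY, pairsIn_comm G Y X]
      ring
    have h2 : (pairsIn G X Y : ℝ) ≤ #X * #Y := by exact_mod_cast pairsIn_le_mul G X Y
    rw [h1, card_union_of_disjoint hXY]
    push_cast
    nlinarith [sq_nonneg ((#X : ℝ) - #Y)]
  refine ⟨X, Y, linkedPair_of_dense hm (by have := P.two_le; omega) hdeg hXY hX hY, ?_, ?_⟩
  · have h1 := core_cofinite P.one_le P.le_n he (by exact_mod_cast hlarge) hD2 hU'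
    have h2 : n ≤ #(X ∪ Y) + 15 * t := by exact_mod_cast h1
    have := card_add_card_compl (X ∪ Y)
    omega
  · intro v hv
    have := hdeg v hv
    omega

end Core

section Partition

variable {V : Type*} [Fintype V] [DecidableEq V] {G : SimpleGraph V} [DecidableRel G.Adj]

theorem pairsIn_add_mul_le {X Y P Q : Finset V} (hP : P ⊆ X) (hQ : Q ⊆ Y)
    (h : ∀ x ∈ P, ∀ y ∈ Q, ¬ G.Adj x y) : pairsIn G X Y + #P * #Q ≤ #X * #Y := by
  obtain ⟨X', rfl, hX'⟩ : ∃ X', P ∪ X' = X ∧ Disjoint P X' :=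
    ⟨X \ P, union_sdiff_of_subset hP, disjoint_sdiff⟩
  obtain ⟨Y', rfl, hY'⟩ : ∃ Y', Q ∪ Y' = Y ∧ Disjoint Q Y' :=
    ⟨Y \ Q, union_sdiff_of_subset hQ, disjoint_sdiff⟩
  rw [pairsIn_union_left G hX', pairsIn_union_right G hY', pairsIn_eq_zero G h,
    card_union_of_disjoint hX']
  have h1 := pairsIn_le_mul G P Y'
  have h2 := pairsIn_le_mul G X' (Q ∪ Y')
  rw [card_union_of_disjoint hY'] at h2 ⊢
  nlinarith

theorem two_mul_card_edgeFinset {B X Y : Finset V} (hXY : Disjoint X Y) (hB : X ∪ Y = Bᶜ)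
    (hX : ∀ x ∈ X, ∀ y ∈ X, ¬ G.Adj x y) (hY : ∀ x ∈ Y, ∀ y ∈ Y, ¬ G.Adj x y) :
    2 * #G.edgeFinset = 2 * pairsIn G X Y + 2 * pairsIn G B Bᶜ + pairsIn G B B := by
  have hd : Disjoint B Bᶜ := disjoint_compl_right
  have h1 : pairsIn G Bᶜ Bᶜ = 2 * pairsIn G X Y := by
    rw [← hB, pairsIn_union_left G hXY, pairsIn_union_right G hXY, pairsIn_union_right G hXY,
      pairsIn_eq_zero G hX, pairsIn_eq_zero G hY, pairsIn_comm G Y X]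
    ring
  rw [← pairsIn_univ, ← union_compl B, pairsIn_union_left G hd, pairsIn_union_right G hd,
    pairsIn_union_right G hd, h1, pairsIn_comm G Bᶜ B]
  ring

theorem card_edgeFinset_le {B X Y : Finset V} (hXY : Disjoint X Y) (hB : X ∪ Y = Bᶜ)
    (hX : ∀ x ∈ X, ∀ y ∈ X, ¬ G.Adj x y) (hY : ∀ x ∈ Y, ∀ y ∈ Y, ¬ G.Adj x y) :
    #G.edgeFinset ≤ pairsIn G X Y + ∑ v ∈ B, G.degree v := by
  have h1 := two_mul_card_edgeFinset hXY hB hX hY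
  have h2 : ∑ v ∈ B, G.degree v = pairsIn G B Bᶜ + pairsIn G B B := by
    rw [pairsIn, pairsIn, ← sum_add_distrib]
    refine sum_congr rfl fun v _ => ?_
    rw [← degIn_univ, ← union_compl B, degIn_union G disjoint_compl_right, add_comm]
  omega

theorem degIn_mono {U W : Finset V} (h : U ⊆ W) (v : V) : degIn G U v ≤ degIn G W v :=
  card_le_card (filter_subset_filter _ h)

/-- The vertices outside `B` without neighbours in `X`. -/
def farFrom (G : SimpleGraph V) [DecidableRel G.Adj] (B X : Finset V) : Finset V :=
  {v | v ∉ B ∧ degIn G X v = 0}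

theorem mem_farFrom {B X : Finset V} {v : V} :
    v ∈ farFrom G B X ↔ v ∉ B ∧ degIn G X v = 0 := by
  simp [farFrom]

theorem indep_farFrom {k : ℕ} (hk : 2 ≤ k) (hfree : CycleFree G (2 * k + 1))
    {B X Y : Finset V} (L : LinkedPair G (9 * k) X Y)
    (hY : ∀ v ∈ farFrom G B X, 29 ≤ degIn G Y v) :
    ∀ x ∈ farFrom G B X, ∀ y ∈ farFrom G B X, ¬ G.Adj x y := by
  intro x hx y hy
  have hnot : ∀ v ∈ farFrom G B X, v ∉ Y := by
    intro v hv hvY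
    have := L.deg_right v hvY
    have := (mem_farFrom.1 hv).2
    omega
  have hx29 := hY x hx
  have hy29 := hY y hy
  obtain ⟨y', hy'Y, hxy', -⟩ := exists_adj_notMem (G := G) (F := ∅) (U := Y) (v := x)
    (by rw [card_empty]; omega)
  obtain ⟨z, hzY, hyz, hz⟩ := exists_adj_notMem (G := G) (F := {y'}) (U := Y) (v := y)
    (by rw [card_singleton]; omega)
  rw [mem_singleton] at hz
  exact L.not_adj_of_adj_right hk hfree hy'Y hzY (Ne.symm hz)
    (fun e => hnot x hx (e ▸ hzY)) (fun e => hnot y hy (e ▸ hy'Y)) hxy' hyz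

theorem LinkedPair.farFrom_partition {k : ℕ} (hk : 2 ≤ k) (hfree : CycleFree G (2 * k + 1))
    {B X Y : Finset V} (L : LinkedPair G (9 * k) X Y)
    (hB : ∀ v ∉ B, 29 ≤ degIn G (X ∪ Y) v) :
    Disjoint (farFrom G B X) (farFrom G B Y) ∧ farFrom G B X ∪ farFrom G B Y = Bᶜ ∧
      (∀ v ∈ farFrom G B X, 29 ≤ degIn G Y v) ∧ (∀ v ∈ farFrom G B Y, 29 ≤ degIn G X v) := by
  have hsplit : ∀ v ∉ B, 29 ≤ degIn G X v + degIn G Y v := fun v hv => by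
    rw [← degIn_union G L.disj]
    exact hB v hv
  refine ⟨disjoint_left.2 fun v hv hv' => ?_, ?_, fun v hv => ?_, fun v hv => ?_⟩
  · rw [mem_farFrom] at hv hv'
    have := hsplit v hv.1
    omega
  · ext v
    simp only [mem_union, mem_farFrom, mem_compl, ← and_or_left, and_iff_left_iff_imp]
    intro hv
    by_contra! hcon
    obtain ⟨x, hx, hvx, -⟩ := exists_adj_notMem (G := G) (F := ∅) (U := X) (v := v)
      (by rw [card_empty]; omega)
    obtain ⟨y, hy, hvy, -⟩ := exists_adj_notMem (G := G) (F := ∅) (U := Y) (v := v)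
      (by rw [card_empty]; omega)
    exact L.not_adj_both hk hfree hx hy hvx hvy
  · rw [mem_farFrom] at hv
    have := hsplit v hv.1
    omega
  · rw [mem_farFrom] at hv
    have := hsplit v hv.1
    omega

theorem degIn_compl_of_indep {B X Y : Finset V} (hXY : Disjoint X Y) (hB : X ∪ Y = Bᶜ)
    (hX : ∀ x ∈ X, ∀ y ∈ X, ¬ G.Adj x y) {x : V} (hx : x ∈ X) :
    degIn G Bᶜ x = degIn G Y x := by
  rw [← hB, degIn_union G hXY, Nat.add_eq_right, degIn, card_eq_zero, filter_eq_empty_iff]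
  exact fun y hy => hX x hx y hy

theorem exists_crossing_edge {X Y : Finset V} {s t : ℝ} (ht : 1 ≤ t) (hts : 22 * t ≤ s)
    (hdegX : ∀ x ∈ X, 2 * s ≤ degIn G Y x + (t + 1))
    (hdegY : ∀ y ∈ Y, 2 * s ≤ degIn G X y + (t + 1))
    (hE : (#X : ℝ) * #Y ≤ pairsIn G X Y + s ^ 2) {x y : V} (hx : x ∈ X) (hy : y ∈ Y) :
    ∃ y' ∈ Y, ∃ x' ∈ X, y' ≠ y ∧ x' ≠ x ∧ G.Adj x y' ∧ G.Adj y' x' ∧ G.Adj x' y := by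
  by_contra! hcon
  have h1 := pairsIn_add_mul_le (G := G) (X := X) (Y := Y)
    (P := {x' ∈ X | G.Adj y x'}.erase x) (Q := {y' ∈ Y | G.Adj x y'}.erase y)
    ((erase_subset _ _).trans (filter_subset _ _)) ((erase_subset _ _).trans (filter_subset _ _))
    (by
      intro x' hx' y' hy' hadj
      simp only [mem_erase, mem_filter] at hx' hy'
      exact hcon y' hy'.2.1 x' hx'.2.1 hy'.1 hx'.1 hy'.2.2 hadj.symm hx'.2.2.symm)
  have h2 : degIn G X y ≤ #({x' ∈ X | G.Adj y x'}.erase x) + 1 := by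
    have := pred_card_le_card_erase (s := {x' ∈ X | G.Adj y x'}) (a := x)
    unfold degIn
    omega
  have h3 : degIn G Y x ≤ #({y' ∈ Y | G.Adj x y'}.erase y) + 1 := by
    have := pred_card_le_card_erase (s := {y' ∈ Y | G.Adj x y'}) (a := y)
    unfold degIn
    omega
  generalize #({x' ∈ X | G.Adj y x'}.erase x) = p at h1 h2
  generalize #({y' ∈ Y | G.Adj x y'}.erase y) = q at h1 h3
  have h1' : (pairsIn G X Y : ℝ) + p * q ≤ #X * #Y := by exact_mod_cast h1
  have h2' : (degIn G X y : ℝ) ≤ p + 1 := by exact_mod_cast h2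
  have h3' : (degIn G Y x : ℝ) ≤ q + 1 := by exact_mod_cast h3
  have h4 := hdegX x hx
  have h5 := hdegY y hy
  have h6 : 3 / 2 * s * (3 / 2 * s) ≤ (p : ℝ) * q := by
    apply mul_le_mul <;> linarith
  nlinarith

theorem exists_goodPartition {k n t : ℕ} {s : ℝ} (P : ParamBounds k n t s)
    (hcard : Fintype.card V = n) (hfree : CycleFree G (2 * k + 1))
    (he : ((n : ℝ) - t - 1) ^ 2 + 2 * ((t + 2) * (t + 1)) ≤ 4 * #G.edgeFinset + 3)
    {B : Finset V} (hB : ∀ v, v ∈ B ↔ (G.degree v : ℝ) < 2 * s) :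
    #B ≤ t + 1 ∧ ∃ X Y X₀ Y₀ : Finset V, GoodPartition G k B X Y X₀ Y₀ ∧
      4 * ((#X : ℝ) * #Y) + ((#X : ℝ) - #Y) ^ 2 ≤ 4 * pairsIn G X Y + 4 * s ^ 2 := by
  obtain ⟨X₀, Y₀, L, hU, hdegU⟩ := exists_linkedPair P hcard hfree he
  have ht := P.one_le
  have hts := P.t_le
  have hsn := P.s_le
  have hs0 : 0 ≤ s := by linarith
  have hBU : #B ≤ 15 * t := by
    refine le_trans (card_le_card fun v hv => ?_) hU
    rw [mem_compl]
    intro hvU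
    have h1 : degIn G (X₀ ∪ Y₀) v ≤ G.degree v := by
      rw [← degIn_univ]
      exact degIn_mono (subset_univ _) v
    have h2 : (78 : ℝ) * n < 500 * G.degree v := by
      exact_mod_cast (hdegU v hvU).trans_le (Nat.mul_le_mul_left 500 h1)
    have h3 := (hB v).1 hv
    linarith
  have hlow : ∀ v ∉ B, 29 ≤ degIn G (X₀ ∪ Y₀) v := by
    intro v hv
    rw [hB, not_lt] at hv
    have h1 : (G.degree v : ℝ) ≤ degIn G (X₀ ∪ Y₀) v + 15 * t := by
      exact_mod_cast (degree_le_degIn_add G (X₀ ∪ Y₀) v).trans (Nat.add_le_add_left hU _)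
    have h2 : (29 : ℝ) ≤ degIn G (X₀ ∪ Y₀) v := by linarith
    exact_mod_cast h2
  obtain ⟨hdisj, hunion, hX29, hY29⟩ := L.farFrom_partition P.two_le hfree hlow
  have hX := indep_farFrom P.two_le hfree L hX29
  have hY := indep_farFrom P.two_le hfree L.symm hY29
  generalize farFrom G B X₀ = X at *
  generalize farFrom G B Y₀ = Y at *
  have hpq : (#X : ℝ) + #Y + #B = n := by
    have h1 := card_add_card_compl B
    rw [← hunion, card_union_of_disjoint hdisj, hcard] at h1
    have h2 : #X + #Y + #B = n := by omega
    exact_mod_cast h2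
  have hEpq : (pairsIn G X Y : ℝ) ≤ #X * #Y := by exact_mod_cast pairsIn_le_mul G X Y
  have hE : (#G.edgeFinset : ℝ) ≤ pairsIn G X Y + 2 * s * #B := by
    have h1 : (#G.edgeFinset : ℝ) ≤ pairsIn G X Y + ∑ v ∈ B, (G.degree v : ℝ) := by
      exact_mod_cast card_edgeFinset_le hdisj hunion hX hY
    have h2 : ∑ v ∈ B, (G.degree v : ℝ) ≤ #B • (2 * s) :=
      sum_le_card_nsmul _ _ _ fun v hv => ((hB v).1 hv).le
    rw [nsmul_eq_mul] at h2
    linarith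
  have hb : #B ≤ t + 1 := by
    have h1 := card_bad_bound ht P.le_n P.s_mul_le hs0 he hE hpq hEpq (by exact_mod_cast hBU)
    have h2 : #B < t + 2 := by exact_mod_cast h1
    omega
  have hb' : (#B : ℝ) ≤ t + 1 := by exact_mod_cast hb
  have hmiss := missing_bound ht hsn hs0 P.sq_eq he hE hpq (Nat.cast_nonneg _) hb'
  have hdeg : ∀ v ∉ B, 2 * s ≤ (degIn G Bᶜ v : ℝ) + (t + 1) := by
    intro v hv
    rw [hB, not_lt] at hv
    have h1 := degree_le_degIn_add G Bᶜ v
    rw [compl_compl] at h1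
    have h2 : (G.degree v : ℝ) ≤ degIn G Bᶜ v + #B := by exact_mod_cast h1
    linarith
  have hdegX : ∀ x ∈ X, 2 * s ≤ (degIn G Y x : ℝ) + (t + 1) := by
    intro x hx
    rw [← degIn_compl_of_indep hdisj hunion hX hx]
    exact hdeg x (mem_compl.1 (hunion ▸ mem_union_left _ hx))
  have hdegY : ∀ y ∈ Y, 2 * s ≤ (degIn G X y : ℝ) + (t + 1) := by
    intro y hy
    rw [← degIn_compl_of_indep hdisj.symm ((union_comm _ _).trans hunion) hY hy]
    exact hdeg y (mem_compl.1 (hunion ▸ mem_union_right _ hy))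
  refine ⟨hb, X, Y, X₀, Y₀, ?_, hmiss⟩
  refine ⟨L, hdisj, hunion, hX, hY, hX29, hY29, fun x hx => ?_, fun y hy => ?_,
    fun x hx y hy => exists_crossing_edge ht hts hdegX hdegY ?_ hx hy⟩
  · have h1 : (2 : ℝ) ≤ degIn G Y x := by linarith [hdegX x hx]
    exact_mod_cast h1
  · have h1 : (2 : ℝ) ≤ degIn G X y := by linarith [hdegY y hy]
    exact_mod_cast h1
  · nlinarith [sq_nonneg ((#X : ℝ) - #Y)]

end Partition

section Pentagon

variable {V : Type*} [Fintype V] [DecidableEq V] {G : SimpleGraph V} [DecidableRel G.Adj]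

theorem CycleFree.false_of_pentagon (hfree : CycleFree G 5) {a b c d e : V} (hab : G.Adj a b)
    (hbc : G.Adj b c) (hcd : G.Adj c d) (hde : G.Adj d e) (hea : G.Adj e a) (hac : a ≠ c)
    (had : a ≠ d) (hbd : b ≠ d) (hbe : b ≠ e) (hce : c ≠ e) : False := by
  have h1 : HasPath G {c, b, a} 1 d e :=
    HasPath.cons (c := e) (HasPath.refl (by simp [hce.symm, hbe.symm, hea.ne, hde.ne'])) hde
      (by simp [hcd.ne', hbd.symm, had.symm])
  have h2 : HasPath G {b, a} 2 c e := HasPath.cons h1 hcd (by simp [hbc.ne', hac.symm])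
  have h3 : HasPath G {a} 3 b e := HasPath.cons h2 hbc (by simpa using hab.ne')
  have h4 : HasPath G ∅ 4 a e := HasPath.cons h3 hab (by simp)
  exact h4.not_cycleFree hea hfree

theorem pairsIn_self_add_card_le (B : Finset V) : pairsIn G B B + #B ≤ #B * #B := by
  have h1 : ∀ v ∈ B, degIn G B v + 1 ≤ #B := by
    intro v hv
    have h2 : degIn G B v ≤ #(B.erase v) := by
      refine card_le_card fun w hw => ?_
      rw [mem_filter] at hw
      exact mem_erase.2 ⟨hw.2.ne', hw.1⟩
    rw [card_erase_of_mem hv] at h2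
    have := card_pos.2 ⟨v, hv⟩
    omega
  have h3 := sum_le_card_nsmul B _ _ h1
  rw [sum_add_distrib, sum_const, smul_eq_mul, smul_eq_mul, mul_one] at h3
  exact h3

theorem pairsIn_le_of_few_low {X Y A : Finset V} (hA : A ⊆ X) {c : ℝ}
    (h : ∀ x ∈ A, (degIn G Y x : ℝ) ≤ c) :
    (pairsIn G X Y : ℝ) ≤ (#X - #A) * #Y + #A * c := by
  obtain ⟨X', rfl, hX'⟩ : ∃ X', A ∪ X' = X ∧ Disjoint A X' :=
    ⟨X \ A, union_sdiff_of_subset hA, disjoint_sdiff⟩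
  rw [pairsIn_union_left G hX', card_union_of_disjoint hX']
  have h1 : (pairsIn G X' Y : ℝ) ≤ #X' * #Y := by exact_mod_cast pairsIn_le_mul G X' Y
  have h2 := sum_le_card_nsmul A _ _ h
  rw [nsmul_eq_mul] at h2
  have h3 : (pairsIn G A Y : ℝ) ≤ #A * c := by
    rw [pairsIn]
    exact_mod_cast h2
  push_cast
  linarith

theorem pairsIn_pair_le {X Y W : Finset V} (hW : W ⊆ X) {a b : V} (ha : a ∈ W) (hb : b ∈ W)
    (hab : a ≠ b) (hsum : degIn G Y a + degIn G Y b ≤ #Y) (h : ∀ x ∈ W, degIn G Y x + 2 ≤ #Y) :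
    pairsIn G X Y + #Y + 2 * #W ≤ #X * #Y + 4 := by
  have h1 : pairsIn G X Y = pairsIn G W Y + pairsIn G (X \ W) Y := by
    rw [← pairsIn_union_left G disjoint_sdiff, union_sdiff_of_subset hW]
  have hb' : b ∈ W.erase a := mem_erase.2 ⟨hab.symm, hb⟩
  have h2 : pairsIn G W Y =
      degIn G Y a + (degIn G Y b + ∑ x ∈ (W.erase a).erase b, degIn G Y x) := by
    rw [pairsIn, ← add_sum_erase _ _ ha, ← add_sum_erase _ _ hb']
  have h3 : ∑ x ∈ (W.erase a).erase b, (degIn G Y x + 2) ≤ #((W.erase a).erase b) • #Y :=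
    sum_le_card_nsmul _ _ _ fun x hx => h x (mem_of_mem_erase (mem_of_mem_erase hx))
  have h4 := pairsIn_le_mul G (X \ W) Y
  have h5 : #W = #((W.erase a).erase b) + 2 := by
    rw [← card_erase_add_one ha, ← card_erase_add_one hb']
  have h6 : #X = #W + #(X \ W) := by
    rw [← card_union_of_disjoint disjoint_sdiff, union_sdiff_of_subset hW]
  rw [sum_add_distrib, sum_const, smul_eq_mul, smul_eq_mul] at h3
  rw [h1, h2, h6, h5]
  nlinarith

namespace GoodPartition

variable {k : ℕ} {B X Y X₀ Y₀ : Finset V}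

theorem card_add_card (P : GoodPartition G k B X Y X₀ Y₀) :
    #X + #Y + #B = Fintype.card V := by
  rw [← card_union_of_disjoint P.disj, P.union, add_comm, card_add_card_compl]

theorem degIn_compl_of_adj (P : GoodPartition G k B X Y X₀ Y₀) (hk : 2 ≤ k)
    (hfree : CycleFree G (2 * k + 1)) {u x : V} (hu : u ∈ B) (hx : x ∈ X) (hux : G.Adj u x) :
    degIn G Bᶜ u = degIn G X u := by
  rw [← P.union, degIn_union G P.disj, Nat.add_eq_left, degIn, card_eq_zero,
    filter_eq_empty_iff]
  exact fun y hy huy => P.not_adj_both hk hfree hu hx hy hux huy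

theorem not_adj_pair_of_pentagon_free (P : GoodPartition G 2 B X Y X₀ Y₀)
    (hfree : CycleFree G 5) {n t : ℕ} {s : ℝ} (hP : ParamBounds 2 n t s) (ht : t ≤ 2)
    (hcard : Fintype.card V = n) (hb : #B ≤ t + 1) (hlow : ∀ v ∈ B, (G.degree v : ℝ) < 2 * s)
    (he : ((n : ℝ) - t - 1) ^ 2 + 2 * ((t + 2) * (t + 1)) ≤ 4 * #G.edgeFinset + 3)
    {u v x y : V} (hu : u ∈ B) (hv : v ∈ B) (hx : x ∈ X) (hy : y ∈ X) (hxy : x ≠ y)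
    (hux : G.Adj u x) (hvy : G.Adj v y) : ¬ G.Adj u v := by
  intro huv
  have hpair : ∀ p ∈ X, ∀ q ∈ X, p ≠ q → G.Adj u p → G.Adj v q →
      degIn G Y p + degIn G Y q ≤ #Y := by
    intro p hp q hq hpq hup hvq
    rw [degIn, degIn, ← card_union_of_disjoint]
    · exact card_le_card (union_subset (filter_subset _ _) (filter_subset _ _))
    · rw [disjoint_filter]
      intro z hz hpz hqz
      have hzB := P.notMem_right hz
      have hpB := P.notMem_left hp
      have hqB := P.notMem_left hq
      exact hfree.false_of_pentagon hup hpz hqz.symm hvq.symm huv.symm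
        (fun e => hzB (e ▸ hu)) (fun e => hqB (e ▸ hu)) hpq (fun e => hpB (e ▸ hv))
        (fun e => hzB (e ▸ hv))
  set W : Finset V := {z ∈ X | G.Adj u z ∨ G.Adj v z}
  have hWX : W ⊆ X := filter_subset _ _
  have hxW : x ∈ W := mem_filter.2 ⟨hx, Or.inl hux⟩
  have hyW : y ∈ W := mem_filter.2 ⟨hy, Or.inr hvy⟩
  have hxy2 := hpair x hx y hy hxy hux hvy
  have hx2 := P.deg_left x hx
  have hy2 := P.deg_left y hy
  have hW : ∀ z ∈ W, degIn G Y z + 2 ≤ #Y := by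
    intro z hz
    obtain ⟨hzX, hz⟩ := mem_filter.1 hz
    rcases eq_or_ne z x with rfl | hzx
    · omega
    rcases eq_or_ne z y with rfl | hzy
    · omega
    rcases hz with hz | hz
    · have := hpair z hzX y hy hzy hz hvy
      omega
    · have := hpair x hx z hzX hzx.symm hux hz
      omega
  have hE := pairsIn_pair_le hWX hxW hyW hxy hxy2 hW
  have hdu : degIn G Bᶜ u ≤ #W := by
    rw [P.degIn_compl_of_adj le_rfl hfree hu hx hux]
    exact card_le_card (monotone_filter_right _ fun z _ h => Or.inl h)
  have hdv : degIn G Bᶜ v ≤ #W := by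
    rw [P.degIn_compl_of_adj le_rfl hfree hv hy hvy]
    exact card_le_card (monotone_filter_right _ fun z _ h => Or.inr h)
  have hv' : v ∈ B.erase u := mem_erase.2 ⟨huv.ne', hv⟩
  have hbc : #B = #((B.erase u).erase v) + 2 := by
    rw [← card_erase_add_one hu, ← card_erase_add_one hv']
  have hC : pairsIn G B Bᶜ =
      degIn G Bᶜ u + (degIn G Bᶜ v + ∑ z ∈ (B.erase u).erase v, degIn G Bᶜ z) := by
    rw [pairsIn, ← add_sum_erase _ _ hu, ← add_sum_erase _ _ hv']
  have hrest : ∑ z ∈ (B.erase u).erase v, (degIn G Bᶜ z : ℝ) ≤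
      #((B.erase u).erase v) • (2 * s) := by
    refine sum_le_card_nsmul _ _ _ fun z hz => le_trans ?_
      (hlow z (mem_of_mem_erase (mem_of_mem_erase hz))).le
    rw [← degIn_univ]
    exact_mod_cast degIn_mono (subset_univ _) z
  rw [nsmul_eq_mul] at hrest
  have he2 := two_mul_card_edgeFinset P.disj P.union P.indep_left P.indep_right
  have hBB := pairsIn_self_add_card_le (G := G) B
  have hsum := P.card_add_card
  rw [hcard] at hsum
  have hn := hP.le_n
  have hsn := hP.s_le
  have hts := hP.t_le
  have ht1 : 1 ≤ t := by exact_mod_cast hP.one_le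
  have hE' : (pairsIn G X Y : ℝ) + #Y + 2 * #W ≤ #X * #Y + 4 := by exact_mod_cast hE
  have hC' : (pairsIn G B Bᶜ : ℝ) ≤ 2 * #W + #((B.erase u).erase v) * (2 * s) := by
    have h1 : (degIn G Bᶜ u : ℝ) ≤ #W := by exact_mod_cast hdu
    have h2 : (degIn G Bᶜ v : ℝ) ≤ #W := by exact_mod_cast hdv
    rw [hC]
    push_cast
    linarith
  have he2' : (2 : ℝ) * #G.edgeFinset =
      2 * pairsIn G X Y + 2 * pairsIn G B Bᶜ + pairsIn G B B := by exact_mod_cast he2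
  have hXY : 4 * ((#X : ℝ) * #Y - #Y) ≤ ((#X : ℝ) + #Y - 1) ^ 2 := by
    nlinarith [sq_nonneg ((#X : ℝ) - 1 - #Y)]
  have hsum' : (#X : ℝ) + #Y = n - #B := by
    have : (#X : ℝ) + #Y + #B = n := by exact_mod_cast hsum
    linarith
  rw [hsum'] at hXY
  have hBB' : (pairsIn G B B : ℝ) + #B ≤ #B * #B := by exact_mod_cast hBB
  obtain ⟨h0, rfl⟩ | ⟨h0, rfl⟩ | ⟨h0, rfl⟩ : (#((B.erase u).erase v) = 0 ∧ t = 1) ∨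
      (#((B.erase u).erase v) = 0 ∧ t = 2) ∨ (#((B.erase u).erase v) = 1 ∧ t = 2) := by omega
  all_goals
    rw [h0] at hbc hC'
    rw [hbc] at hBB' hXY
    push_cast at *
    nlinarith

theorem not_path_of_pentagon_free (P : GoodPartition G 2 B X Y X₀ Y₀)
    (hfree : CycleFree G 5) {n t : ℕ} (ht : t ≤ 2)
    (hcard : Fintype.card V = n) (hb : #B ≤ t + 1)
    (he : ((n : ℝ) - t - 1) ^ 2 + 2 * ((t + 2) * (t + 1)) ≤ 4 * #G.edgeFinset + 3)
    {u w v x y : V} (hu : u ∈ B) (hw : w ∈ B) (hv : v ∈ B) (huv : u ≠ v) (hx : x ∈ X)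
    (hy : y ∈ Y) (hux : G.Adj u x) (hvy : G.Adj v y) (huw : G.Adj u w) (hwv : G.Adj w v)
    (hw1 : degIn G Bᶜ w ≤ 1) : False := by
  have hv' : v ∈ (B.erase u).erase w :=
    mem_erase.2 ⟨hwv.ne', mem_erase.2 ⟨huv.symm, hv⟩⟩
  have hw' : w ∈ B.erase u := mem_erase.2 ⟨huw.ne', hw⟩
  have hbc : #B = #(((B.erase u).erase w).erase v) + 1 + 1 + 1 := by
    rw [← card_erase_add_one hu, ← card_erase_add_one hw', ← card_erase_add_one hv']
  obtain rfl : t = 2 := by omega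
  have h0 : #(((B.erase u).erase w).erase v) = 0 := by omega
  have hC : pairsIn G B Bᶜ = degIn G Bᶜ u + (degIn G Bᶜ w + (degIn G Bᶜ v + 0)) := by
    rw [pairsIn, ← add_sum_erase _ _ hu, ← add_sum_erase _ _ hw', ← add_sum_erase _ _ hv',
      card_eq_zero.1 h0, sum_empty]
  rw [P.degIn_compl_of_adj le_rfl hfree hu hx hux,
    P.symm.degIn_compl_of_adj le_rfl hfree hv hy hvy] at hC
  have hE := pairsIn_add_mul_le (G := G) (X := X) (Y := Y) (P := {z ∈ X | G.Adj u z})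
    (Q := {z ∈ Y | G.Adj v z}) (filter_subset _ _) (filter_subset _ _) (by
      intro p hp q hq hpq
      rw [mem_filter] at hp hq
      have hpB := P.notMem_left hp.1
      have hqB := P.notMem_right hq.1
      exact hfree.false_of_pentagon huw hwv hq.2 hpq.symm hp.2.symm huv
        (fun e => hqB (e ▸ hu)) (fun e => hqB (e ▸ hw)) (fun e => hpB (e ▸ hw))
        (fun e => hpB (e ▸ hv)))
  change pairsIn G X Y + degIn G X u * degIn G Y v ≤ _ at hE
  have hdu : 1 ≤ degIn G X u := card_pos.2 ⟨x, mem_filter.2 ⟨hx, hux⟩⟩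
  have hdv : 1 ≤ degIn G Y v := card_pos.2 ⟨y, mem_filter.2 ⟨hy, hvy⟩⟩
  have he2 := two_mul_card_edgeFinset P.disj P.union P.indep_left P.indep_right
  have hBB := pairsIn_self_add_card_le (G := G) B
  have hsum := P.card_add_card
  rw [hcard] at hsum
  rw [hbc, h0] at hBB hsum
  have hprod : degIn G X u + degIn G Y v ≤ degIn G X u * degIn G Y v + 1 := by nlinarith
  have he5 : #G.edgeFinset ≤ #X * #Y + 5 := by omega
  have he5' : (#G.edgeFinset : ℝ) ≤ #X * #Y + 5 := by exact_mod_cast he5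
  have hsum' : (n : ℝ) = #X + #Y + 3 := by exact_mod_cast hsum.symm
  rw [hsum'] at he
  push_cast at he
  nlinarith [sq_nonneg ((#X : ℝ) - #Y)]

end GoodPartition

end Pentagon

section Structure

variable {V : Type*} [Fintype V] [DecidableEq V] {G : SimpleGraph V} [DecidableRel G.Adj]

theorem GoodPartition.card_low_le {k n t : ℕ} {s r : ℝ} {B X Y X₀ Y₀ : Finset V}
    (Q : GoodPartition G k B X Y X₀ Y₀) (P : ParamBounds k n t s)
    (hcard : Fintype.card V = n) (hb : #B ≤ t + 1) (hr : r ^ 2 = 3 * s ^ 2) (hr0 : 0 ≤ r)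
    (hmiss : 4 * ((#X : ℝ) * #Y) + ((#X : ℝ) - #Y) ^ 2 ≤ 4 * pairsIn G X Y + 4 * s ^ 2) :
    (#{v | v ∉ B ∧ (degIn G Bᶜ v : ℝ) ≤ n / 2 - r} : ℝ) ≤ 3 / 2 * s := by
  have hsum : (#X : ℝ) + #Y + #B = n := by
    rw [← hcard]
    exact_mod_cast Q.card_add_card
  have hEpq : (pairsIn G X Y : ℝ) ≤ #X * #Y := by exact_mod_cast pairsIn_le_mul G X Y
  have h1 := pairsIn_le_of_few_low (G := G) (Y := Y)
    (filter_subset (fun v => (degIn G Y v : ℝ) ≤ n / 2 - r) X) fun v hv => (mem_filter.1 hv).2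
  have h2 := pairsIn_le_of_few_low (G := G) (Y := X)
    (filter_subset (fun v => (degIn G X v : ℝ) ≤ n / 2 - r) Y) fun v hv => (mem_filter.1 hv).2
  rw [pairsIn_comm] at h2
  refine le_trans ?_ (few_low_bound P.t_le P.one_le hr hr0 hsum (by exact_mod_cast hb) hEpq hmiss
    (Nat.cast_nonneg _) (Nat.cast_nonneg _) h1 h2)
  norm_cast
  refine le_trans (card_le_card fun v hv => ?_) (card_union_le _ _)
  obtain ⟨hvB, hv⟩ := (mem_filter.1 hv).2
  have hvXY := mem_compl.2 hvB
  rw [← Q.union] at hvXY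
  rcases mem_union.1 hvXY with hvX | hvY
  · rw [degIn_compl_of_indep Q.disj Q.union Q.indep_left hvX] at hv
    exact mem_union_left _ (mem_filter.2 ⟨hvX, hv⟩)
  · rw [degIn_compl_of_indep Q.symm.disj Q.symm.union Q.indep_right hvY] at hv
    exact mem_union_right _ (mem_filter.2 ⟨hvY, hv⟩)

/-- The structure of a dense `C_{2k+1}`-free graph, in terms of finsets. -/
theorem exists_structure {k n t : ℕ} {s : ℝ} (P : ParamBounds k n t s) (ht2 : t ≤ 2 * k - 2)
    (hcard : Fintype.card V = n) (hfree : CycleFree G (2 * k + 1))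
    (he : ((n : ℝ) - t - 1) ^ 2 + 2 * ((t + 2) * (t + 1)) ≤ 4 * #G.edgeFinset + 3)
    {B : Finset V} (hB : ∀ v, v ∈ B ↔ (G.degree v : ℝ) < 2 * s) :
    #B ≤ t + 1 ∧ ∃ X Y : Finset V, Disjoint X Y ∧ X ∪ Y = Bᶜ ∧
      (∀ x ∈ X, ∀ y ∈ X, ¬ G.Adj x y) ∧ (∀ x ∈ Y, ∀ y ∈ Y, ¬ G.Adj x y) ∧
      ((n : ℝ) / 2 - 2 * s ≤ #X ∧ (#X : ℝ) ≤ n / 2 + 2 * s) ∧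
      ((n : ℝ) / 2 - 2 * s ≤ #Y ∧ (#Y : ℝ) ≤ n / 2 + 2 * s) ∧
      (∀ r : ℝ, 0 ≤ r → r ^ 2 = 3 * s ^ 2 →
        (#{v | v ∉ B ∧ (degIn G Bᶜ v : ℝ) ≤ n / 2 - r} : ℝ) ≤ 3 / 2 * s) ∧
      (∀ v ∈ B, ∀ x ∈ X, ∀ y ∈ Y, G.Adj v x → ¬ G.Adj v y) ∧
      (∀ u ∈ B, ∀ v ∈ B, ∀ x ∈ X, ∀ y ∈ X, x ≠ y → G.Adj u x → G.Adj v y → ¬ G.Adj u v) ∧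
      (∀ u ∈ B, ∀ v ∈ B, ∀ x ∈ Y, ∀ y ∈ Y, x ≠ y → G.Adj u x → G.Adj v y → ¬ G.Adj u v) ∧
      (∀ u ∈ B, ∀ w ∈ B, ∀ v ∈ B, u ≠ v → G.Adj u w → G.Adj w v → degIn G Bᶜ w ≤ 1 →
        ∀ x ∈ X, ∀ y ∈ Y, G.Adj u x → ¬ G.Adj v y) := by
  obtain ⟨hb, X, Y, X₀, Y₀, Q, hmiss⟩ := exists_goodPartition P hcard hfree he hB
  have hk := P.two_le
  have hb' : (#B : ℝ) ≤ t + 1 := by exact_mod_cast hb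
  have hsum : (#X : ℝ) + #Y + #B = n := by
    rw [← hcard]
    exact_mod_cast Q.card_add_card
  have hEpq : (pairsIn G X Y : ℝ) ≤ #X * #Y := by exact_mod_cast pairsIn_le_mul G X Y
  have hpair : ∀ {X Y X₀ Y₀ : Finset V}, GoodPartition G k B X Y X₀ Y₀ → ∀ u ∈ B, ∀ v ∈ B,
      ∀ x ∈ X, ∀ y ∈ X, x ≠ y → G.Adj u x → G.Adj v y → ¬ G.Adj u v := by
    intro X Y X₀ Y₀ Q u hu v hv x hx y hy hxy hux hvy
    rcases hk.eq_or_lt with rfl | hk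
    · exact Q.not_adj_pair_of_pentagon_free hfree P ht2 hcard hb (fun v hv => (hB v).1 hv) he
        hu hv hx hy hxy hux hvy
    · exact Q.not_adj_pair hk hfree hu hv hx hy hxy hux hvy
  refine ⟨hb, X, Y, Q.disj, Q.union, Q.indep_left, Q.indep_right,
    part_size_bound P.t_le P.one_le hsum (Nat.cast_nonneg _) hb' hEpq hmiss,
    part_size_bound (E := pairsIn G X Y) (q := #X) P.t_le P.one_le (by linarith)
      (Nat.cast_nonneg _) hb' (by linarith) (by linarith),
    fun r hr0 hr => Q.card_low_le P hcard hb hr hr0 hmiss,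
    fun v hv x hx y hy => Q.not_adj_both hk hfree hv hx hy, hpair Q, hpair Q.symm, ?_⟩
  intro u hu w hw v hv huv huw hwv hw1 x hx y hy hux hvy
  rcases hk.eq_or_lt with rfl | hk
  · exact Q.not_path_of_pentagon_free hfree ht2 hcard hb he hu hw hv huv hx hy hux hvy huw hwv hw1
  · exact Q.not_path_of_adj hk hfree hu hw hv huv hx hy hux hvy huw hwv

end Structure

end DenseGraphs

/-- Structure lemma: for a `C_{2k+1}`-free graph `G` on `n ≥ 252t²k` vertices with
`e(G) ≥ ⌊(n-t-1)²/4⌋ + C(t+2,2)`, where `B` is the set of vertices of degree less than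
`2√(tn)`, we have `|B| ≤ t+1` and `V(G) \ B` can be partitioned into sets `X` and `Y`
spanning no edges, such that conditions (ii)-(vi) hold.  The degree in `G - B` of a vertex
`v ∉ B` is `|{w | w ~ v, w ∉ B}|`. -/
theorem stmt13 {V : Type*} [Fintype V] (G : SimpleGraph V) [DecidableRel G.Adj]
    (k n t : ℕ) (hk : 2 ≤ k) (ht1 : 1 ≤ t) (ht2 : t ≤ 2 * k - 2)
    (hn : 252 * t ^ 2 * k ≤ n)
    (hcard : Fintype.card V = n)
    (hfree : CycleFree G (2 * k + 1))
    (hedge : (n - t - 1) ^ 2 / 4 + (t + 2).choose 2 ≤ G.edgeFinset.card)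
    (B : Set V) (hB : B = {v : V | (G.degree v : ℝ) < 2 * Real.sqrt (t * n)}) :
    B.ncard ≤ t + 1 ∧
    ∃ X Y : Set V,
      Disjoint X Y ∧ X ∪ Y = Bᶜ ∧
      (∀ x ∈ X, ∀ y ∈ X, ¬ G.Adj x y) ∧
      (∀ x ∈ Y, ∀ y ∈ Y, ¬ G.Adj x y) ∧
      -- (ii) sizes of the parts
      ((n : ℝ) / 2 - 2 * Real.sqrt (t * n) ≤ (X.ncard : ℝ) ∧
        (X.ncard : ℝ) ≤ (n : ℝ) / 2 + 2 * Real.sqrt (t * n)) ∧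
      ((n : ℝ) / 2 - 2 * Real.sqrt (t * n) ≤ (Y.ncard : ℝ) ∧
        (Y.ncard : ℝ) ≤ (n : ℝ) / 2 + 2 * Real.sqrt (t * n)) ∧
      -- (iii) few vertices of small degree in G - B
      (({v : V | v ∉ B ∧ (({w : V | G.Adj v w ∧ w ∉ B}.ncard : ℝ) ≤
          (n : ℝ) / 2 - Real.sqrt (3 * t * n))}.ncard : ℝ) ≤ 3 / 2 * Real.sqrt (t * n)) ∧
      -- (iv) neighbors of vertices of B in X ∪ Y lie in one part
      (∀ v ∈ B, (∀ w, G.Adj v w → w ∈ X ∪ Y → w ∈ X) ∨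
        (∀ w, G.Adj v w → w ∈ X ∪ Y → w ∈ Y)) ∧
      -- (v) edges inside B
      (∀ u ∈ B, ∀ v ∈ B, G.Adj u v →
        (¬ ∃ x₁ ∈ X, ∃ x₂ ∈ X, x₁ ≠ x₂ ∧ G.Adj u x₁ ∧ G.Adj v x₂) ∧
        (¬ ∃ y₁ ∈ Y, ∃ y₂ ∈ Y, y₁ ≠ y₂ ∧ G.Adj u y₁ ∧ G.Adj v y₂)) ∧
      -- (vi) paths u-w-v inside B
      (∀ u ∈ B, ∀ w ∈ B, ∀ v ∈ B, u ≠ w → w ≠ v → u ≠ v →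
        G.Adj u w → G.Adj w v →
        {x : V | x ∈ X ∪ Y ∧ G.Adj w x}.ncard ≤ 1 →
        ¬ ∃ x ∈ X, ∃ y ∈ Y,
          (G.Adj u y ∧ G.Adj v x) ∨ (G.Adj u x ∧ G.Adj v y)) := by
  classical
  have P := paramBounds_sqrt hk ht1 ht2 hn
  have htn : t + 1 ≤ n := by
    have h1 := P.le_n
    have h2 := P.one_le
    have h3 : (t : ℝ) + 1 ≤ n := by linarith
    exact_mod_cast h3
  have he := edge_bound_real htn hedge
  obtain ⟨A, rfl⟩ : ∃ A : Finset V, B = A := ⟨B.toFinset, by simp⟩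
  have hA : ∀ v, v ∈ A ↔ (G.degree v : ℝ) < 2 * Real.sqrt (t * n) := fun v => by
    rw [← Finset.mem_coe, hB, Set.mem_ofPred_eq]
  have hr : Real.sqrt (3 * t * n) ^ 2 = 3 * Real.sqrt (t * n) ^ 2 := by
    rw [Real.sq_sqrt (by positivity), Real.sq_sqrt (by positivity), mul_assoc]
  obtain ⟨hb, X, Y, hXY, hunion, hX, hY, hX2, hY2, hlow, hside, hpairX, hpairY, hpath⟩ :=
    exists_structure P ht2 hcard hfree (by convert he) hA
  have hdeg : ∀ v, {w : V | G.Adj v w ∧ w ∉ (A : Set V)}.ncard = degIn G Aᶜ v := fun v => by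
    rw [degIn, ← Set.ncard_coe_finset]
    congr 1
    ext w
    simp [and_comm]
  refine ⟨by rwa [Set.ncard_coe_finset], X, Y, Finset.disjoint_coe.2 hXY, ?_, hX, hY, ?_, ?_, ?_,
    ?_, ?_, ?_⟩
  · rw [← Finset.coe_union, hunion, Finset.coe_compl]
  · rwa [Set.ncard_coe_finset]
  · rwa [Set.ncard_coe_finset]
  · have h := hlow _ (Real.sqrt_nonneg _) hr
    rw [← Set.ncard_coe_finset, Finset.coe_filter] at h
    simp only [hdeg]
    simpa only [Finset.mem_univ, true_and, Finset.mem_coe] using h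
  · intro v hv
    by_cases h : ∃ x ∈ X, G.Adj v x
    · obtain ⟨x, hx, hvx⟩ := h
      exact Or.inl fun w hvw hw => hw.resolve_right fun hwY => hside v hv x hx w hwY hvx hvw
    · push Not at h
      exact Or.inr fun w hvw hw => hw.resolve_left fun hwX => h w hwX hvw
  · intro u hu v hv huv
    constructor
    · rintro ⟨x, hx, y, hy, hxy, hux, hvy⟩
      exact hpairX u hu v hv x hx y hy hxy hux hvy huv
    · rintro ⟨x, hx, y, hy, hxy, hux, hvy⟩
      exact hpairY u hu v hv x hx y hy hxy hux hvy huv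
  · intro u hu w hw v hv _ _ huv huw hwv hw1
    have hw1' : degIn G Aᶜ w ≤ 1 := by
      rw [← hdeg]
      convert hw1 using 3
      ext x
      rw [and_comm, ← Finset.coe_union, hunion, Finset.coe_compl, Set.mem_compl_iff]
    rintro ⟨x, hx, y, hy, ⟨huy, hvx⟩ | ⟨hux, hvy⟩⟩
    · exact hpath v hv w hw u hu huv.symm hwv.symm huw.symm hw1' x hx y hy hvx huy
    · exact hpath u hu w hw v hv huv huw hwv hw1' x hx y hy hux hvy
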